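/- If K ⊂ ℝ^d is a self-nesting body, then every uniformly recurrent dense packing P of K is limit-equivalent to a completely saturated packing: there exists a completely saturated packing Q with Q ≽_L P and P ≽_L Q. -/

import Mathlib

open MeasureTheory Metric Filter Pointwise
open scoped ENNReal NNReal

noncomputable section

abbrev Euc (d : ℕ) : Type := EuclideanSpace ℝ (Fin d)

/-- A body: a compact domain (compact set equal to the closure of its interior). -/
def IsBody {d : ℕ} (K : Set (Euc d)) : Prop :=
  IsCompact K ∧ K = closure (interior K)

/-- `D` is an isometric copy of `K`. -/
def IsIsomCopy {d : ℕ} (K D : Set (Euc d)) : Prop :=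
  ∃ f : Euc d ≃ᵢ Euc d, D = f '' K

def PairwiseDisjointInteriors {d : ℕ} (P : Set (Set (Euc d))) : Prop :=
  P.Pairwise fun D E => interior D ∩ interior E = ∅

/-- A packing of the body `K`: a collection of isometric copies of `K`
with pairwise disjoint interiors. -/
def IsPacking {d : ℕ} (K : Set (Euc d)) (P : Set (Set (Euc d))) : Prop :=
  (∀ D ∈ P, IsIsomCopy K D) ∧ PairwiseDisjointInteriors P

/-- Translate every element of a collection by the vector `v`. -/
def translatePacking {d : ℕ} (v : Euc d) (P : Set (Set (Euc d))) : Set (Set (Euc d)) :=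
  (fun D => (fun x => x + v) '' D) '' P

/-- The fraction of the ball `B(p,r)` covered by the collection `P`
(the sum over elements of `P` of the volume of the intersection, divided
by the volume of the ball). -/
def ballFrac {d : ℕ} (P : Set (Set (Euc d))) (p : Euc d) (r : ℝ) : ℝ :=
  ((∑' D : P, volume ((D : Set (Euc d)) ∩ ball p r)) / volume (ball p r)).toReal

/-- `P` has density `δ`. -/
def HasDensity {d : ℕ} (P : Set (Set (Euc d))) (δ : ℝ) : Prop :=
  ∀ p : Euc d, Tendsto (fun r => ballFrac P p r) atTop (nhds δ)

/-- `P` has density `δ` uniformly in the center point. -/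
def HasUniformDensity {d : ℕ} (P : Set (Set (Euc d))) (δ : ℝ) : Prop :=
  TendstoUniformly (fun r (p : Euc d) => ballFrac P p r) (fun _ => δ) atTop

/-- The packing density of the body `K`. -/
def packingDensity {d : ℕ} (K : Set (Euc d)) : ℝ :=
  sSup {δ : ℝ | ∃ P, IsPacking K P ∧ HasDensity P δ}

/-- Modified Hausdorff distance at most `ε` between two collections: there is a
relation between elements, related elements are at Hausdorff distance at most `ε`,
and every element meeting the ball `B(0,1/ε)` is related to a unique element on
the other side. -/
def PackingClose {d : ℕ} (ε : ℝ) (P Q : Set (Set (Euc d))) : Prop :=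
  ∃ R : Set (Euc d) → Set (Euc d) → Prop,
    (∀ A B, R A B → A ∈ P ∧ B ∈ Q ∧ Metric.hausdorffDist A B ≤ ε) ∧
    (∀ A ∈ P, (A ∩ ball (0 : Euc d) (1 / ε)).Nonempty → ∃! B, R A B) ∧
    (∀ B ∈ Q, (B ∩ ball (0 : Euc d) (1 / ε)).Nonempty → ∃! A, R A B)

/-- Convergence of a sequence of collections to `Q` in the modified Hausdorff topology. -/
def PackingTendsto {d : ℕ} (Ps : ℕ → Set (Set (Euc d))) (Q : Set (Set (Euc d))) : Prop :=
  ∀ ε : ℝ, 0 < ε → ∀ᶠ n in atTop, PackingClose ε (Ps n) Q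

/-- `A ≽_L B` : some sequence of translates of `B` converges to `A`. -/
def IsLimitOf {d : ℕ} (A B : Set (Set (Euc d))) : Prop :=
  ∃ v : ℕ → Euc d, PackingTendsto (fun n => translatePacking (v n) B) A

/-- A packing of `K` is uniformly recurrent if it is maximal with respect to `≽_L`
among packings of `K`. -/
def UniformlyRecurrent {d : ℕ} (K : Set (Euc d)) (A : Set (Set (Euc d))) : Prop :=
  ∀ B, IsPacking K B → IsLimitOf B A → IsLimitOf A B

/-- `P` is `n`-saturated: one cannot remove `n-1` of its elements and replace them
by `n` isometric copies of `K` so that the result is still a packing. -/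
def Saturated {d : ℕ} (K : Set (Euc d)) (n : ℕ) (P : Set (Set (Euc d))) : Prop :=
  ¬ ∃ F G : Finset (Set (Euc d)), ↑F ⊆ P ∧ F.card = n - 1 ∧ G.card = n ∧
      Disjoint (↑G : Set (Set (Euc d))) (P \ ↑F) ∧
      IsPacking K ((P \ ↑F) ∪ ↑G)

def CompletelySaturated {d : ℕ} (K : Set (Euc d)) (P : Set (Set (Euc d))) : Prop :=
  ∀ n : ℕ, 1 ≤ n → Saturated K n P

/-- `K` (strictly) self-nests: for every `ε > 0` some isometric copy of `K` lies in
the interior of `(1+ε)K`. -/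
def SelfNests {d : ℕ} (K : Set (Euc d)) : Prop :=
  ∀ ε : ℝ, 0 < ε → ∃ f : Euc d ≃ᵢ Euc d, f '' K ⊆ interior ((1 + ε) • K)

/-- A single connected replacement: `A` is obtained from `B` by replacing `k < n`
copies of `K` by `k+1` copies so that the union of the `2k+1` copies involved is
connected. -/
def ConnStep {d : ℕ} (K : Set (Euc d)) (n : ℕ) (B A : Set (Set (Euc d))) : Prop :=
  ∃ (k : ℕ) (F G : Finset (Set (Euc d))), k < n ∧ ↑F ⊆ B ∧ F.card = k ∧ G.card = k + 1 ∧
    Disjoint (↑G : Set (Set (Euc d))) (B \ ↑F) ∧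
    A = (B \ ↑F) ∪ ↑G ∧ IsPacking K A ∧
    IsConnected (⋃ D ∈ (↑F ∪ ↑G : Set (Set (Euc d))), D)

/-- `A ≽_{C,n} B` : `A` is obtained from `B` by finitely many connected replacements. -/
def ConnGE {d : ℕ} (K : Set (Euc d)) (n : ℕ) (A B : Set (Set (Euc d))) : Prop :=
  Relation.ReflTransGen (ConnStep K n) B A

/-- The density function of the convolution `μ * χ_P` evaluated at the point `p`:
`∑_{D ∈ P} μ {x | p - x ∈ D}`. -/
def diffuse {d : ℕ} (μ : Measure (Euc d)) (P : Set (Set (Euc d))) (p : Euc d) : ℝ≥0∞ :=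
  ∑' D : P, μ {x : Euc d | p - x ∈ (D : Set (Euc d))}

/-- The value of the measure `χ_P * μ` on the (Borel) set `R`. -/
def diffuseOn {d : ℕ} (μ : Measure (Euc d)) (P : Set (Set (Euc d))) (R : Set (Euc d)) : ℝ≥0∞ :=
  ∫⁻ p in R, diffuse μ P p

/-- The measure with density `(n/(n+1))^{|x|/(2n-1)}` with respect to Lebesgue measure. -/
def kupMeasure (d n : ℕ) : Measure (Euc d) :=
  volume.withDensity fun x =>
    ENNReal.ofReal (((n : ℝ) / (n + 1)) ^ (‖x‖ / (2 * (n : ℝ) - 1)))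

/-- A generic packing: a collection of bodies with pairwise disjoint interiors. -/
def IsGenPacking {d : ℕ} (P : Set (Set (Euc d))) : Prop :=
  (∀ D ∈ P, IsBody D) ∧ PairwiseDisjointInteriors P

/-- `A ≽_μ B` : `μ * χ_A ≥ μ * χ_B` everywhere. -/
def MuDom {d : ℕ} (μ : Measure (Euc d)) (A B : Set (Set (Euc d))) : Prop :=
  ∀ p : Euc d, diffuse μ B p ≤ diffuse μ A p

/-- `A ≽_D B` : `A` diffusively dominates `B`. -/
def DiffDom {d : ℕ} (A B : Set (Set (Euc d))) : Prop :=
  ∃ μ : Measure (Euc d), IsFiniteMeasure μ ∧ MuDom μ A B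

/-- `P` is weakly recurrent if it is the limit of a sequence of uniformly
recurrent packings of `K`. -/
def WeaklyRecurrent {d : ℕ} (K : Set (Euc d)) (P : Set (Set (Euc d))) : Prop :=
  ∃ Bs : ℕ → Set (Set (Euc d)),
    (∀ i, IsPacking K (Bs i) ∧ UniformlyRecurrent K (Bs i)) ∧ PackingTendsto Bs P

section Copies

variable {d : ℕ} {K A B D E : Set (Euc d)}

theorem IsIsomCopy.isCompact (hK : IsCompact K) (h : IsIsomCopy K D) : IsCompact D := by
  obtain ⟨f, rfl⟩ := h
  exact hK.image f.continuous

theorem IsIsomCopy.nonempty (hne : K.Nonempty) (h : IsIsomCopy K D) : D.Nonempty := by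
  obtain ⟨f, rfl⟩ := h
  exact hne.image f

theorem IsIsomCopy.image (h : IsIsomCopy K D) (f : Euc d ≃ᵢ Euc d) : IsIsomCopy K (f '' D) := by
  obtain ⟨g, rfl⟩ := h
  exact ⟨g.trans f, by rw [← Set.image_comp]; rfl⟩

theorem interior_image_isometryEquiv (f : Euc d ≃ᵢ Euc d) (D : Set (Euc d)) :
    interior (f '' D) = f '' interior D :=
  (f.toHomeomorph.image_interior D).symm

theorem IsBody.interior_nonempty (hK : IsBody K) (hne : K.Nonempty) : (interior K).Nonempty := by
  rw [hK.2] at hne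
  exact closure_nonempty_iff.1 hne

theorem IsIsomCopy.interior_nonempty (hK : IsBody K) (hne : K.Nonempty) (h : IsIsomCopy K D) :
    (interior D).Nonempty := by
  obtain ⟨f, rfl⟩ := h
  rw [interior_image_isometryEquiv]
  exact (hK.interior_nonempty hne).image f

theorem IsIsomCopy.dist_le (hK : IsCompact K) (h : IsIsomCopy K D) {x y : Euc d}
    (hx : x ∈ D) (hy : y ∈ D) : dist x y ≤ diam K := by
  obtain ⟨f, rfl⟩ := h
  obtain ⟨a, ha, rfl⟩ := hx
  obtain ⟨b, hb, rfl⟩ := hy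
  rw [f.dist_eq]
  exact dist_le_diam_of_mem hK.isBounded ha hb

theorem volume_image_isometryEquiv (f : Euc d ≃ᵢ Euc d) (D : Set (Euc d)) :
    volume (f '' D) = volume D := by
  have h : f '' D = (fun x => x + f 0) '' (f.toRealLinearIsometryEquiv '' D) := by
    rw [← Set.image_comp]
    refine Set.image_congr fun x _ => ?_
    simp [IsometryEquiv.toRealLinearIsometryEquiv_apply]
  rw [h, Set.image_add_right, measure_preimage_add_right,
    LinearIsometryEquiv.image_eq_preimage_symm]
  exact f.toRealLinearIsometryEquiv.symm.measurePreserving.measure_preimage_emb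
    f.toRealLinearIsometryEquiv.symm.toHomeomorph.measurableEmbedding D

theorem IsIsomCopy.volume_eq (h : IsIsomCopy K D) : volume D = volume K := by
  obtain ⟨f, rfl⟩ := h
  exact volume_image_isometryEquiv f K

theorem IsIsomCopy.volume_interior_eq (h : IsIsomCopy K D) :
    volume (interior D) = volume (interior K) := by
  obtain ⟨f, rfl⟩ := h
  rw [interior_image_isometryEquiv, volume_image_isometryEquiv]

theorem IsIsomCopy.hausdorffEDist_ne_top (hK : IsCompact K) (hne : K.Nonempty)
    (hA : IsIsomCopy K A) (hB : IsIsomCopy K B) : hausdorffEDist A B ≠ ⊤ :=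
  hausdorffEDist_ne_top_of_nonempty_of_bounded (hA.nonempty hne) (hB.nonempty hne)
    (hA.isCompact hK).isBounded (hB.isCompact hK).isBounded

theorem IsIsomCopy.hausdorffDist_triangle (hK : IsCompact K) (hne : K.Nonempty)
    (hA : IsIsomCopy K A) (hB : IsIsomCopy K B) :
    hausdorffDist A D ≤ hausdorffDist A B + hausdorffDist B D :=
  Metric.hausdorffDist_triangle (hA.hausdorffEDist_ne_top hK hne hB)

theorem IsIsomCopy.exists_dist_lt (hK : IsCompact K) (hne : K.Nonempty)
    (hA : IsIsomCopy K A) (hB : IsIsomCopy K B) {ε : ℝ} (h : hausdorffDist A B < ε) {x : Euc d}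
    (hx : x ∈ A) : ∃ y ∈ B, dist x y < ε :=
  exists_dist_lt_of_hausdorffDist_lt hx h (hA.hausdorffEDist_ne_top hK hne hB)

/-- Convergence of sets in the Hausdorff distance along a filter. -/
def HausdorffTendsto {ι : Type*} (l : Filter ι) (A : ι → Set (Euc d)) (B : Set (Euc d)) : Prop :=
  ∀ ε > 0, ∀ᶠ i in l, hausdorffDist (A i) B ≤ ε

theorem eq_of_hausdorffTendsto {ι : Type*} {l : Filter ι} [l.NeBot] (hK : IsCompact K)
    (hne : K.Nonempty) {A : ι → Set (Euc d)} (hA : ∀ᶠ i in l, IsIsomCopy K (A i))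
    (hB : IsIsomCopy K B) (hD : IsIsomCopy K D) (h₁ : HausdorffTendsto l A B)
    (h₂ : HausdorffTendsto l A D) : B = D := by
  have h0 : hausdorffDist B D = 0 := by
    refine le_antisymm (le_of_forall_pos_le_add fun ε hε => ?_) hausdorffDist_nonneg
    obtain ⟨i, hi, h1, h2⟩ := (hA.and ((h₁ (ε / 2) (by positivity)).and
      (h₂ (ε / 2) (by positivity)))).exists
    have := hB.hausdorffDist_triangle (D := D) hK hne hi
    rw [hausdorffDist_comm] at h1
    linarith
  exact ((hB.isCompact hK).isClosed.hausdorffDist_zero_iff_eq (hD.isCompact hK).isClosed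
    (hB.hausdorffEDist_ne_top hK hne hD)).1 h0

/-- Isometries sending the origin to bounded points converge pointwise, together with their
inverses, along any ultrafilter. -/
theorem exists_isometryEquiv_tendsto {ι : Type*} (U : Ultrafilter ι) (f : ι → Euc d ≃ᵢ Euc d)
    (C : ℝ) (h : ∀ᶠ i in (U : Filter ι), dist (f i 0) 0 ≤ C) :
    ∃ g : Euc d ≃ᵢ Euc d, ∀ x, Tendsto (fun i => f i x) U (nhds (g x)) := by
  have key : ∀ (F : ι → Euc d) (r : ℝ), (∀ᶠ i in (U : Filter ι), dist (F i) 0 ≤ r) →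
      ∃ y, Tendsto F U (nhds y) := by
    intro F r hF
    obtain ⟨y, -, hy⟩ := isCompact_iff_ultrafilter_le_nhds.1 (isCompact_closedBall (0 : Euc d) r)
      (U.map F) (le_principal_iff.2 hF)
    exact ⟨y, hy⟩
  have h1 : ∀ x, ∃ y, Tendsto (fun i => f i x) U (nhds y) := fun x =>
    key _ (dist x 0 + C) (h.mono fun i hi => by
      have := dist_triangle (f i x) (f i 0) 0
      rw [(f i).dist_eq] at this
      linarith)
  have h2 : ∀ x, ∃ y, Tendsto (fun i => (f i).symm x) U (nhds y) := fun x =>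
    key _ (dist x 0 + C) (h.mono fun i hi => by
      have h3 := (f i).dist_eq ((f i).symm x) 0
      have := dist_triangle x 0 (f i 0)
      rw [IsometryEquiv.apply_symm_apply] at h3
      rw [dist_comm 0] at this
      linarith)
  choose g hg using h1
  choose g' hg' using h2
  have hiso : Isometry g := Isometry.of_dist_eq fun x y =>
    tendsto_nhds_unique ((hg x).dist (hg y)) (by
      simp only [IsometryEquiv.dist_eq]
      exact tendsto_const_nhds)
  have hinv : ∀ y, g (g' y) = y := fun y => by
    refine tendsto_nhds_unique (hg (g' y)) ?_
    rw [tendsto_iff_dist_tendsto_zero]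
    have h3 := (tendsto_iff_dist_tendsto_zero.1 (hg' y))
    refine h3.congr fun i => ?_
    rw [← (f i).dist_eq, IsometryEquiv.apply_symm_apply, dist_comm]
  exact ⟨IsometryEquiv.mk' g g' hinv hiso, hg⟩

theorem hausdorffTendsto_image {ι : Type*} {l : Filter ι} (hK : IsCompact K)
    {f : ι → Euc d ≃ᵢ Euc d} {g : Euc d ≃ᵢ Euc d}
    (h : ∀ x, Tendsto (fun i => f i x) l (nhds (g x))) :
    HausdorffTendsto l (fun i => f i '' K) (g '' K) := by
  intro ε hε
  obtain ⟨t, -, ht, hKt⟩ := hK.finite_cover_balls (e := ε / 3) (by positivity)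
  have h1 : ∀ᶠ i in l, ∀ x ∈ t, dist (f i x) (g x) < ε / 3 :=
    (eventually_all_finite ht).2 fun x _ => Metric.tendsto_nhds.1 (h x) _ (by positivity)
  filter_upwards [h1] with i hi
  have h2 : ∀ x ∈ K, dist (f i x) (g x) ≤ ε := by
    intro x hx
    obtain ⟨y, hy, hxy⟩ := Set.mem_iUnion₂.1 (hKt hx)
    rw [mem_ball] at hxy
    have a1 := dist_triangle4 (f i x) (f i y) (g y) (g x)
    rw [(f i).dist_eq, g.dist_eq, dist_comm y x] at a1
    linarith [hi y hy]
  refine hausdorffDist_le_of_mem_dist hε.le ?_ ?_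
  · rintro _ ⟨x, hx, rfl⟩
    exact ⟨g x, ⟨x, hx, rfl⟩, h2 x hx⟩
  · rintro _ ⟨x, hx, rfl⟩
    exact ⟨f i x, ⟨x, hx, rfl⟩, by rw [dist_comm]; exact h2 x hx⟩

/-- Copies of a compact set meeting a fixed ball converge along any ultrafilter, and so do
isometries realizing them. -/
theorem exists_isometryEquiv_hausdorffTendsto {ι : Type*} (U : Ultrafilter ι) (hK : IsCompact K)
    {f : ι → Euc d ≃ᵢ Euc d} {r : ℝ}
    (h : ∀ᶠ i in (U : Filter ι), (f i '' K ∩ closedBall 0 r).Nonempty) :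
    ∃ g : Euc d ≃ᵢ Euc d, (∀ x, Tendsto (fun i => f i x) U (nhds (g x))) ∧
      HausdorffTendsto U (fun i => f i '' K) (g '' K) := by
  obtain ⟨R, hR⟩ := hK.isBounded.subset_closedBall (0 : Euc d)
  obtain ⟨g, hg⟩ := exists_isometryEquiv_tendsto U f (R + r) (h.mono fun i hi => by
    obtain ⟨_, ⟨x, hx, rfl⟩, hr⟩ := hi
    have h1 := dist_triangle (f i 0) (f i x) 0
    rw [(f i).dist_eq, dist_comm 0 x] at h1
    have h2 := hR hx
    rw [mem_closedBall] at h2 hr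
    linarith)
  exact ⟨g, hg, hausdorffTendsto_image hK hg⟩

theorem exists_isIsomCopy_hausdorffTendsto {ι : Type*} (U : Ultrafilter ι) (hK : IsCompact K)
    {A : ι → Set (Euc d)} {r : ℝ} (hA : ∀ᶠ i in (U : Filter ι), IsIsomCopy K (A i))
    (h : ∀ᶠ i in (U : Filter ι), (A i ∩ closedBall 0 r).Nonempty) :
    ∃ B, IsIsomCopy K B ∧ HausdorffTendsto U A B := by
  classical
  let f : ι → Euc d ≃ᵢ Euc d := fun i => if hi : IsIsomCopy K (A i) then hi.choose else .refl _
  have hf : ∀ᶠ i in (U : Filter ι), A i = f i '' K := hA.mono fun i hi => by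
    simp only [f, dif_pos hi]
    exact hi.choose_spec
  obtain ⟨g, -, hg⟩ := exists_isometryEquiv_hausdorffTendsto U hK (f := f) (r := r)
    ((h.and hf).mono fun i hi => hi.2 ▸ hi.1)
  refine ⟨g '' K, ⟨g, rfl⟩, fun ε hε => ?_⟩
  filter_upwards [hg ε hε, hf] with i h1 h2
  rwa [h2]

theorem hausdorffTendsto_eventually_meets {ι : Type*} {l : Filter ι} (hK : IsCompact K)
    (hne : K.Nonempty) {A : ι → Set (Euc d)} (hA : ∀ᶠ i in l, IsIsomCopy K (A i))
    (hB : IsIsomCopy K B) (h : HausdorffTendsto l A B) :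
    ∃ r, ∀ᶠ i in l, (A i ∩ closedBall 0 r).Nonempty := by
  obtain ⟨b, hb⟩ := hB.nonempty hne
  refine ⟨dist b 0 + 1, ?_⟩
  filter_upwards [h (1 / 2) (by norm_num), hA] with i hi hAi
  rw [hausdorffDist_comm] at hi
  obtain ⟨y, hy, hby⟩ := hB.exists_dist_lt hK hne hAi (lt_of_le_of_lt hi one_half_lt_one) hb
  refine ⟨y, hy, ?_⟩
  rw [mem_closedBall]
  have := dist_triangle y b 0
  rw [dist_comm y b] at this
  linarith

/-- An interior point of a Hausdorff limit of copies is eventually interior to the copies. -/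
theorem eventually_mem_interior {ι : Type*} (U : Ultrafilter ι) (hK : IsCompact K)
    (hne : K.Nonempty) {A : ι → Set (Euc d)} (hA : ∀ᶠ i in (U : Filter ι), IsIsomCopy K (A i))
    (hB : IsIsomCopy K B) (h : HausdorffTendsto U A B) {x : Euc d} (hx : x ∈ interior B) :
    ∀ᶠ i in (U : Filter ι), x ∈ interior (A i) := by
  classical
  obtain ⟨r, hr⟩ := hausdorffTendsto_eventually_meets hK hne hA hB h
  let f : ι → Euc d ≃ᵢ Euc d := fun i => if hi : IsIsomCopy K (A i) then hi.choose else .refl _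
  have hf : ∀ᶠ i in (U : Filter ι), A i = f i '' K := hA.mono fun i hi => by
    simp only [f, dif_pos hi]
    exact hi.choose_spec
  obtain ⟨g, hg, hgK⟩ := exists_isometryEquiv_hausdorffTendsto U hK (f := f) (r := r)
    ((hr.and hf).mono fun i hi => hi.2 ▸ hi.1)
  have hBg : B = g '' K := eq_of_hausdorffTendsto hK hne hA hB ⟨g, rfl⟩ h fun ε hε => by
    filter_upwards [hgK ε hε, hf] with i h1 h2
    rwa [h2]
  rw [hBg, interior_image_isometryEquiv] at hx
  obtain ⟨y, hy, rfl⟩ := hx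
  have h1 : Tendsto (fun i => (f i).symm (g y)) U (nhds y) := by
    rw [tendsto_iff_dist_tendsto_zero]
    refine (tendsto_iff_dist_tendsto_zero.1 (hg y)).congr fun i => ?_
    rw [← (f i).dist_eq ((f i).symm (g y)), IsometryEquiv.apply_symm_apply, dist_comm]
  filter_upwards [hf, h1 (isOpen_interior.mem_nhds hy)] with i h2 h3
  rw [h2, interior_image_isometryEquiv]
  exact ⟨_, h3, (f i).apply_symm_apply _⟩

theorem interior_inter_eq_empty_of_tendsto {ι : Type*} (U : Ultrafilter ι) (hK : IsCompact K)
    (hne : K.Nonempty) {A B : ι → Set (Euc d)} (hA : ∀ᶠ i in (U : Filter ι), IsIsomCopy K (A i))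
    (hB : ∀ᶠ i in (U : Filter ι), IsIsomCopy K (B i)) (hD : IsIsomCopy K D) (hE : IsIsomCopy K E)
    (hAD : HausdorffTendsto U A D) (hBE : HausdorffTendsto U B E)
    (h : ∀ᶠ i in (U : Filter ι), interior (A i) ∩ interior (B i) = ∅) :
    interior D ∩ interior E = ∅ := by
  rw [Set.eq_empty_iff_forall_notMem]
  rintro x ⟨h1, h2⟩
  obtain ⟨i, h3, h4, h5⟩ := (h.and ((eventually_mem_interior U hK hne hA hD hAD h1).and
    (eventually_mem_interior U hK hne hB hE hBE h2))).exists
  exact (Set.eq_empty_iff_forall_notMem.1 h3) x ⟨h4, h5⟩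

theorem hausdorffDist_image_isometryEquiv (f : Euc d ≃ᵢ Euc d) :
    hausdorffDist (f '' A) (f '' B) = hausdorffDist A B :=
  hausdorffDist_image f.isometry

/-- Copies of a body that are close to each other overlap. -/
theorem exists_pos_interior_inter_nonempty (hK : IsBody K) (hne : K.Nonempty) :
    ∃ ε > 0, ∀ A B, IsIsomCopy K A → IsIsomCopy K B → hausdorffDist A B ≤ ε →
      (interior A ∩ interior B).Nonempty := by
  by_contra! hcon
  have h1 : ∀ n : ℕ, ∃ B, IsIsomCopy K B ∧ hausdorffDist B K ≤ 1 / ((n : ℝ) + 1) ∧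
      interior B ∩ interior K = ∅ := by
    intro n
    obtain ⟨A, B, ⟨f, hf⟩, hB, h1, h2⟩ := hcon (1 / ((n : ℝ) + 1)) (by positivity)
    refine ⟨f.symm '' B, hB.image _, ?_, ?_⟩
    · rwa [← hausdorffDist_image_isometryEquiv f, ← Set.image_comp, f.self_comp_symm,
        Set.image_id, ← hf, hausdorffDist_comm]
    · rw [interior_image_isometryEquiv, Set.eq_empty_iff_forall_notMem]
      rintro _ ⟨⟨x, hx, rfl⟩, hx'⟩
      refine Set.eq_empty_iff_forall_notMem.1 h2 x ⟨?_, hx⟩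
      rw [hf, interior_image_isometryEquiv]
      exact ⟨_, hx', f.apply_symm_apply x⟩
  choose B hB hd hint using h1
  have hKK : IsIsomCopy K K := ⟨.refl _, (Set.image_id K).symm⟩
  have h2 := interior_inter_eq_empty_of_tendsto (hyperfilter ℕ) hK.1 hne
    (A := B) (B := fun _ => K) (.of_forall hB) (.of_forall fun _ => hKK) hKK hKK
    (fun ε hε => by
      have h3 : ∀ᶠ n : ℕ in atTop, 1 / ((n : ℝ) + 1) ≤ ε :=
        (tendsto_one_div_add_atTop_nhds_zero_nat.eventually (ge_mem_nhds hε))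
      exact (h3.filter_mono Nat.hyperfilter_le_atTop).mono fun n hn => (hd n).trans hn)
    (fun ε hε => .of_forall fun _ => by simp [hε.le]) (.of_forall hint)
  rw [Set.inter_self] at h2
  exact (hK.interior_nonempty hne).ne_empty h2

end Copies

section Topology

variable {d : ℕ} {K : Set (Euc d)} {P Q S : Set (Set (Euc d))}

/-- Elements of `P` and `Q` meeting the ball of radius `r` are `ε`-close to elements of the
other collection. -/
def PackingNear (r ε : ℝ) (P Q : Set (Set (Euc d))) : Prop :=
  (∀ A ∈ P, (A ∩ closedBall 0 r).Nonempty → ∃ B ∈ Q, hausdorffDist A B ≤ ε) ∧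
  (∀ B ∈ Q, (B ∩ closedBall 0 r).Nonempty → ∃ A ∈ P, hausdorffDist A B ≤ ε)

theorem PackingNear.mono {r r' ε ε' : ℝ} (hr : r' ≤ r) (hε : ε ≤ ε') (h : PackingNear r ε P Q) :
    PackingNear r' ε' P Q := by
  have hb : ∀ A : Set (Euc d), (A ∩ closedBall 0 r').Nonempty → (A ∩ closedBall 0 r).Nonempty :=
    fun A hA => hA.mono (Set.inter_subset_inter_right _ (closedBall_subset_closedBall hr))
  constructor
  · intro A hA h1
    obtain ⟨B, hB, h2⟩ := h.1 A hA (hb A h1)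
    exact ⟨B, hB, h2.trans hε⟩
  · intro A hA h1
    obtain ⟨B, hB, h2⟩ := h.2 A hA (hb A h1)
    exact ⟨B, hB, h2.trans hε⟩

theorem PackingNear.symm {r ε : ℝ} (h : PackingNear r ε P Q) : PackingNear r ε Q P := by
  simp only [PackingNear, hausdorffDist_comm] at h ⊢
  exact ⟨fun A hA h1 => by simpa only [hausdorffDist_comm] using h.2 A hA h1,
    fun A hA h1 => by simpa only [hausdorffDist_comm] using h.1 A hA h1⟩

theorem PackingNear.trans (hK : IsCompact K) (hne : K.Nonempty) (hP : IsPacking K P)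
    (hQ : IsPacking K Q) (hS : IsPacking K S) {r ε ε' : ℝ} (hε : ε < 1) (hε' : ε' < 1)
    (h₁ : PackingNear (r + 1) ε P Q) (h₂ : PackingNear (r + 1) ε' Q S) :
    PackingNear r (ε + ε') P S := by
  have main : ∀ {P Q S : Set (Set (Euc d))} {ε ε' : ℝ}, IsPacking K P → IsPacking K Q → ε < 1 →
      PackingNear (r + 1) ε P Q → PackingNear (r + 1) ε' Q S →
      ∀ A ∈ P, (A ∩ closedBall 0 r).Nonempty → ∃ B ∈ S, hausdorffDist A B ≤ ε + ε' := by
    intro P Q S ε ε' hP hQ hε h₁ h₂ A hA hAr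
    obtain ⟨a, ha, har⟩ := hAr
    rw [mem_closedBall] at har
    obtain ⟨B, hB, hAB⟩ := h₁.1 A hA ⟨a, ha, by rw [mem_closedBall]; linarith⟩
    obtain ⟨b, hb, hab⟩ := (hP.1 A hA).exists_dist_lt hK hne (hQ.1 B hB) (hAB.trans_lt hε) ha
    obtain ⟨C, hC, hBC⟩ := h₂.1 B hB ⟨b, hb, by
      rw [mem_closedBall]
      have := dist_triangle b a 0
      rw [dist_comm b a] at this
      linarith⟩
    exact ⟨C, hC, ((hP.1 A hA).hausdorffDist_triangle hK hne (hQ.1 B hB)).trans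
      (add_le_add hAB hBC)⟩
  refine ⟨main hP hQ hε h₁ h₂, fun B hB h => ?_⟩
  obtain ⟨A, hA, hAB⟩ := main hS hQ hε' h₂.symm h₁.symm B hB h
  exact ⟨A, hA, by rw [hausdorffDist_comm]; linarith⟩

theorem IsPacking.image (hP : IsPacking K P) (f : Euc d ≃ᵢ Euc d) :
    IsPacking K ((fun D => f '' D) '' P) := by
  constructor
  · rintro _ ⟨D, hD, rfl⟩
    exact (hP.1 D hD).image f
  · rintro _ ⟨D, hD, rfl⟩ _ ⟨E, hE, rfl⟩ hDE
    have := hP.2 hD hE fun h => hDE (by rw [h])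
    simp only [interior_image_isometryEquiv]
    rw [← Set.image_inter f.injective, this, Set.image_empty]

theorem IsPacking.translate (hP : IsPacking K P) (v : Euc d) :
    IsPacking K (translatePacking v P) :=
  hP.image (IsometryEquiv.addRight v)

theorem translatePacking_translatePacking (v w : Euc d) :
    translatePacking w (translatePacking v P) = translatePacking (v + w) P := by
  simp only [translatePacking, Set.image_image, add_assoc]

theorem PackingNear.translate {r ε : ℝ} (v : Euc d) (h : PackingNear (r + ‖v‖) ε P Q) :
    PackingNear r ε (translatePacking v P) (translatePacking v Q) := by
  have main : ∀ {P Q : Set (Set (Euc d))}, PackingNear (r + ‖v‖) ε P Q →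
      ∀ A ∈ translatePacking v P, (A ∩ closedBall 0 r).Nonempty →
        ∃ B ∈ translatePacking v Q, hausdorffDist A B ≤ ε := by
    rintro P Q h _ ⟨A, hA, rfl⟩ ⟨_, ⟨x, hx, rfl⟩, hr⟩
    obtain ⟨B, hB, hAB⟩ := h.1 A hA ⟨x, hx, by
      rw [mem_closedBall_zero_iff] at hr ⊢
      have := norm_sub_le (x + v) v
      rw [add_sub_cancel_right] at this
      exact this.trans (add_le_add_left hr _)⟩
    refine ⟨_, ⟨B, hB, rfl⟩, le_of_eq_of_le ?_ hAB⟩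
    exact hausdorffDist_image_isometryEquiv (IsometryEquiv.addRight v)
  refine ⟨main h, fun B hB hr => ?_⟩
  obtain ⟨A, hA, hAB⟩ := main h.symm B hB hr
  exact ⟨A, hA, by rwa [hausdorffDist_comm]⟩

theorem PackingClose.packingNear {r ε ε' : ℝ} (h : PackingClose ε' P Q) (hr : r < 1 / ε')
    (hε : ε' ≤ ε) : PackingNear r ε P Q := by
  obtain ⟨R, h0, h1, h2⟩ := h
  have hb : ∀ A : Set (Euc d), (A ∩ closedBall 0 r).Nonempty →
      (A ∩ ball 0 (1 / ε')).Nonempty := fun A hA =>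
    hA.mono (Set.inter_subset_inter_right _ (closedBall_subset_ball hr))
  constructor
  · intro A hA hAr
    obtain ⟨B, hB, -⟩ := h1 A hA (hb A hAr)
    exact ⟨B, (h0 A B hB).2.1, (h0 A B hB).2.2.trans hε⟩
  · intro B hB hBr
    obtain ⟨A, hA, -⟩ := h2 B hB (hb B hBr)
    exact ⟨A, (h0 A B hA).1, (h0 A B hA).2.2.trans hε⟩

theorem IsLimitOf.exists_packingNear (h : IsLimitOf Q P) (r : ℝ) {ε : ℝ} (hε : 0 < ε) :
    ∃ v, PackingNear r ε (translatePacking v P) Q := by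
  obtain ⟨v, hv⟩ := h
  obtain ⟨n, hn⟩ := (hv (min ε (1 / (|r| + 1))) (by positivity)).exists
  refine ⟨v n, hn.packingNear ?_ (min_le_left _ _)⟩
  calc r ≤ |r| := le_abs_self r
    _ < |r| + 1 := by linarith
    _ = 1 / (1 / (|r| + 1)) := by rw [one_div_one_div]
    _ ≤ 1 / min ε (1 / (|r| + 1)) := by
      apply one_div_le_one_div_of_le (by positivity) (min_le_right _ _)

theorem IsPacking.eq_of_hausdorffDist_le (hP : IsPacking K P) {ε : ℝ} (hK : IsCompact K)
    (hne : K.Nonempty)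
    (hε : ∀ A B, IsIsomCopy K A → IsIsomCopy K B → hausdorffDist A B ≤ ε →
      (interior A ∩ interior B).Nonempty) {A B D : Set (Euc d)} (hA : A ∈ P) (hB : B ∈ P)
    (hD : IsIsomCopy K D) (h₁ : hausdorffDist A D ≤ ε / 2) (h₂ : hausdorffDist B D ≤ ε / 2) :
    A = B := by
  by_contra hAB
  refine (hε A B (hP.1 A hA) (hP.1 B hB) ?_).ne_empty (hP.2 hA hB hAB)
  have := (hP.1 A hA).hausdorffDist_triangle (D := B) hK hne hD
  rw [hausdorffDist_comm (s := D)] at this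
  linarith

theorem packingTendsto_of_packingNear (hK : IsBody K) (hne : K.Nonempty)
    {Ps : ℕ → Set (Set (Euc d))} (hPs : ∀ n, IsPacking K (Ps n)) (hQ : IsPacking K Q)
    (h : ∀ r ε, 0 < ε → ∀ᶠ n in atTop, PackingNear r ε (Ps n) Q) : PackingTendsto Ps Q := by
  intro ε hε
  obtain ⟨ε₀, hε₀, hsep⟩ := exists_pos_interior_inter_nonempty hK hne
  filter_upwards [h (1 / ε) (min ε (ε₀ / 2)) (by positivity)] with n hn
  have hb : ∀ A : Set (Euc d), (A ∩ ball 0 (1 / ε)).Nonempty →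
      (A ∩ closedBall 0 (1 / ε)).Nonempty := fun A hA =>
    hA.mono (Set.inter_subset_inter_right _ ball_subset_closedBall)
  refine ⟨fun A B => A ∈ Ps n ∧ B ∈ Q ∧ hausdorffDist A B ≤ min ε (ε₀ / 2),
    fun A B hAB => ⟨hAB.1, hAB.2.1, hAB.2.2.trans (min_le_left _ _)⟩, ?_, ?_⟩
  · intro A hA hAr
    obtain ⟨B, hB, hAB⟩ := hn.1 A hA (hb A hAr)
    refine ⟨B, ⟨hA, hB, hAB⟩, fun C hC => ?_⟩
    refine hQ.eq_of_hausdorffDist_le hK.1 hne hsep hC.2.1 hB ((hPs n).1 A hA) ?_ ?_ <;>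
      rw [hausdorffDist_comm]
    · exact hC.2.2.trans (min_le_right _ _)
    · exact hAB.trans (min_le_right _ _)
  · intro B hB hBr
    obtain ⟨A, hA, hAB⟩ := hn.2 B hB (hb B hBr)
    refine ⟨A, ⟨hA, hB, hAB⟩, fun C hC => ?_⟩
    exact (hPs n).eq_of_hausdorffDist_le hK.1 hne hsep hC.1 hA (hQ.1 B hB)
      (hC.2.2.trans (min_le_right _ _)) (hAB.trans (min_le_right _ _))

theorem isLimitOf_of_forall_exists_packingNear (hK : IsBody K) (hne : K.Nonempty)
    (hP : IsPacking K P) (hQ : IsPacking K Q)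
    (h : ∀ r ε, 0 < ε → ∃ v, PackingNear r ε (translatePacking v P) Q) : IsLimitOf Q P := by
  choose! v hv using h
  refine ⟨fun n => v n (1 / ((n : ℝ) + 1)),
    packingTendsto_of_packingNear hK hne (fun n => hP.translate _) hQ fun r ε hε => ?_⟩
  have h1 : ∀ᶠ n : ℕ in atTop, 1 / ((n : ℝ) + 1) ≤ ε :=
    tendsto_one_div_add_atTop_nhds_zero_nat.eventually (ge_mem_nhds hε)
  filter_upwards [h1, tendsto_natCast_atTop_atTop.eventually_ge_atTop r] with n h2 h3
  exact (hv n (1 / ((n : ℝ) + 1)) (by positivity)).mono h3 h2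

theorem IsPacking.subset (hP : IsPacking K P) (h : Q ⊆ P) : IsPacking K Q :=
  ⟨fun D hD => hP.1 D (h hD), hP.2.mono h⟩

theorem IsPacking.disjoint_interior (hP : IsPacking K P) {D E : Set (Euc d)} (hD : D ∈ P)
    (hE : E ∈ P) (h : D ≠ E) : Disjoint (interior D) (interior E) :=
  Set.disjoint_iff_inter_eq_empty.2 (hP.2 hD hE h)

/-- Only finitely many elements of a packing meet a bounded set. -/
theorem IsPacking.finite_meeting (hK : IsBody K) (hne : K.Nonempty) (hP : IsPacking K P)
    {T : Set (Euc d)} (hT : Bornology.IsBounded T) : {D ∈ P | (D ∩ T).Nonempty}.Finite := by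
  obtain ⟨R, hR⟩ := hT.subset_closedBall (0 : Euc d)
  have h1 := Measure.finite_const_le_meas_of_disjoint_iUnion (volume : Measure (Euc d))
    (ε := volume (interior K)) (isOpen_interior.measure_pos _ (hK.interior_nonempty hne))
    (As := fun D : {D ∈ P | (D ∩ T).Nonempty} => interior (D : Set (Euc d)))
    (fun D => isOpen_interior.measurableSet)
    (fun D E hDE => hP.disjoint_interior D.2.1 E.2.1 (Subtype.coe_ne_coe.2 hDE))
    (ne_top_of_le_ne_top (isCompact_closedBall (0 : Euc d) (R + diam K)).measure_lt_top.ne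
      (measure_mono ?_))
  · have h2 := h1.subset fun D (_ : D ∈ Set.univ) => (hP.1 _ D.2.1).volume_interior_eq.ge
    exact Set.finite_coe_iff.1 (Set.finite_univ_iff.1 h2)
  · refine Set.iUnion_subset fun D x hx => ?_
    obtain ⟨y, hy, hyT⟩ := D.2.2
    have h2 := (hP.1 _ D.2.1).dist_le hK.1 (interior_subset hx) hy
    have h3 := hR hyT
    rw [mem_closedBall] at h3 ⊢
    linarith [dist_triangle x y 0]

/-- Packings of a body converge along any ultrafilter. -/
theorem exists_isPacking_packingNear {ι : Type*} (U : Ultrafilter ι) (hK : IsBody K)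
    (hne : K.Nonempty) {Ps : ι → Set (Set (Euc d))} (hPs : ∀ i, IsPacking K (Ps i)) :
    ∃ Q, IsPacking K Q ∧ ∀ r ε, 0 < ε → ∀ᶠ i in (U : Filter ι), PackingNear r ε (Ps i) Q := by
  let Q : Set (Set (Euc d)) := {B | IsIsomCopy K B ∧ ∃ A : ι → Set (Euc d),
    (∀ᶠ i in (U : Filter ι), A i ∈ Ps i) ∧ HausdorffTendsto U A B}
  have hQ : IsPacking K Q := by
    refine ⟨fun D hD => hD.1, ?_⟩
    rintro B ⟨hB, A, hA, hAB⟩ C ⟨hC, A', hA', hAC⟩ hBC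
    have hcopy : ∀ᶠ i in (U : Filter ι), IsIsomCopy K (A i) := hA.mono fun i hi => (hPs i).1 _ hi
    have hcopy' : ∀ᶠ i in (U : Filter ι), IsIsomCopy K (A' i) :=
      hA'.mono fun i hi => (hPs i).1 _ hi
    refine interior_inter_eq_empty_of_tendsto U hK.1 hne hcopy hcopy' hB hC hAB hAC ?_
    have hneq : ∀ᶠ i in (U : Filter ι), A i ≠ A' i := by
      refine Ultrafilter.eventually_not.2 fun heq => hBC ?_
      refine eq_of_hausdorffTendsto hK.1 hne hcopy hB hC hAB fun ε hε => ?_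
      filter_upwards [heq, hAC ε hε] with i h1 h2
      rwa [h1]
    filter_upwards [hA, hA', hneq] with i h1 h2 h3
    exact (hPs i).2 h1 h2 h3
  refine ⟨Q, hQ, fun r ε hε => Filter.Eventually.and ?_ ?_⟩
  · by_contra hcon
    rw [← Ultrafilter.eventually_not] at hcon
    push Not at hcon
    have h1 : ∀ i, ∃ A, (∃ A ∈ Ps i, (A ∩ closedBall 0 r).Nonempty ∧
        ∀ B ∈ Q, ε < hausdorffDist A B) → A ∈ Ps i ∧ (A ∩ closedBall 0 r).Nonempty ∧
        ∀ B ∈ Q, ε < hausdorffDist A B := by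
      intro i
      by_cases h : ∃ A ∈ Ps i, (A ∩ closedBall 0 r).Nonempty ∧ ∀ B ∈ Q, ε < hausdorffDist A B
      · obtain ⟨A, hA⟩ := h
        exact ⟨A, fun _ => hA⟩
      · exact ⟨∅, fun h' => (h h').elim⟩
    choose A hA using h1
    have h2 := hcon.mono fun i hi => hA i hi
    obtain ⟨B, hB, hAB⟩ := exists_isIsomCopy_hausdorffTendsto U hK.1 (A := A) (r := r)
      (h2.mono fun i hi => (hPs i).1 _ hi.1) (h2.mono fun i hi => hi.2.1)
    obtain ⟨i, h3, h4⟩ := (h2.and (hAB ε hε)).exists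
    exact absurd h4 (h3.2.2 B ⟨hB, A, h2.mono fun i hi => hi.1, hAB⟩).not_ge
  · have h1 : ∀ᶠ i in (U : Filter ι), ∀ B ∈ {B ∈ Q | (B ∩ closedBall 0 r).Nonempty},
        ∃ A ∈ Ps i, hausdorffDist A B ≤ ε := by
      refine (eventually_all_finite (hQ.finite_meeting hK hne isBounded_closedBall)).2 ?_
      rintro B ⟨⟨-, A, hA, hAB⟩, -⟩
      filter_upwards [hA, hAB ε hε] with i h2 h3
      exact ⟨A i, h2, h3⟩
    exact h1.mono fun i hi B hB hBr => hi B ⟨hB, hBr⟩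

end Topology

section Improvement

variable {d : ℕ} {K : Set (Euc d)} {P Q : Set (Set (Euc d))}

/-- At most `m` elements of `P` in the ball `B(y,r)` can be replaced by `m + 1` copies of `K`
in that ball. -/
def HasImprovement (K : Set (Euc d)) (m : ℕ) (y : Euc d) (r : ℝ) (P : Set (Set (Euc d))) : Prop :=
  ∃ (F : Fin m → Set (Euc d)) (G : Fin (m + 1) → Set (Euc d)),
    (∀ i, F i ∈ P) ∧ (∀ i, F i ⊆ closedBall y r) ∧
    (∀ j, IsIsomCopy K (G j)) ∧ (∀ j, G j ⊆ closedBall y r) ∧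
    (∀ i j, i ≠ j → interior (G i) ∩ interior (G j) = ∅) ∧
    ∀ D ∈ P, (∀ i, D ≠ F i) → ∀ j, interior D ∩ interior (G j) = ∅

theorem completelySaturated_of_forall_not_hasImprovement (hK : IsCompact K) (hQ : IsPacking K Q)
    (h : ∀ m r : ℕ, ¬ HasImprovement K m 0 r Q) : CompletelySaturated K Q := by
  rintro n hn ⟨F, G, hFQ, hF, hG, hdisj, hpack⟩
  have hb : Bornology.IsBounded (⋃ D ∈ (↑F ∪ ↑G : Set (Set (Euc d))), D) := by
    refine (Bornology.isBounded_biUnion (F.finite_toSet.union G.finite_toSet)).2 ?_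
    rintro D (hD | hD)
    · exact ((hQ.1 D (hFQ hD)).isCompact hK).isBounded
    · exact ((hpack.1 D (Or.inr hD)).isCompact hK).isBounded
  obtain ⟨R, hR⟩ := hb.subset_closedBall (0 : Euc d)
  have hR' : ∀ D ∈ (↑F ∪ ↑G : Set (Set (Euc d))), D ⊆ closedBall 0 (⌈R⌉₊ : ℝ) := fun D hD =>
    ((Set.subset_biUnion_of_mem (u := fun D => D) hD).trans hR).trans
      (closedBall_subset_closedBall (Nat.le_ceil R))
  let eF := F.equivFinOfCardEq hF
  let eG := G.equivFinOfCardEq (n := n - 1 + 1) (by omega)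
  refine h (n - 1) ⌈R⌉₊ ⟨fun i => eF.symm i, fun j => eG.symm j, fun i => hFQ (eF.symm i).2,
    fun i => hR' _ (Or.inl (eF.symm i).2), fun j => hpack.1 _ (Or.inr (eG.symm j).2),
    fun j => hR' _ (Or.inr (eG.symm j).2), fun i j hij => ?_, fun D hD hDF j => ?_⟩
  · exact hpack.2 (Or.inr (eG.symm i).2) (Or.inr (eG.symm j).2)
      fun h => hij (eG.symm.injective (Subtype.ext h))
  · have hDF' : D ∉ (↑F : Set (Set (Euc d))) := fun hmem =>
      hDF (eF ⟨D, hmem⟩) (by simp)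
    refine hpack.2 (Or.inl ⟨hD, hDF'⟩) (Or.inr (eG.symm j).2) ?_
    rintro rfl
    exact Set.disjoint_left.1 hdisj (eG.symm j).2 ⟨hD, hDF'⟩

theorem HasImprovement.of_image {m : ℕ} {y : Euc d} {r : ℝ} (f : Euc d ≃ᵢ Euc d)
    (h : HasImprovement K m y r ((fun D => f '' D) '' P)) :
    HasImprovement K m (f.symm y) r P := by
  obtain ⟨F, G, hF, hFr, hG, hGr, hGG, hD⟩ := h
  choose F' hF' hFF' using hF
  obtain rfl : F = fun i => f '' F' i := funext fun i => (hFF' i).symm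
  have hball : ∀ D : Set (Euc d), f '' D ⊆ closedBall y r → D ⊆ closedBall (f.symm y) r := by
    intro D hD x hx
    have := hD ⟨x, hx, rfl⟩
    rw [mem_closedBall, ← f.dist_eq, IsometryEquiv.apply_symm_apply]
    exact this
  have hGf : ∀ j, G j = f '' (f.symm '' G j) := fun j => by
    rw [← Set.image_comp, f.self_comp_symm, Set.image_id]
  have hint : ∀ D E : Set (Euc d), interior (f '' D) ∩ interior (f '' E) = ∅ →
      interior D ∩ interior E = ∅ := by
    intro D E h
    rwa [interior_image_isometryEquiv, interior_image_isometryEquiv, ← Set.image_inter f.injective,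
      Set.image_eq_empty] at h
  refine ⟨F', fun j => f.symm '' G j, hF', fun i => hball _ (hFr i), fun j => (hG j).image _,
    fun j => hball _ (hGf j ▸ hGr j), fun i j hij => hint _ _ ?_, fun D hDP hDF j => hint _ _ ?_⟩
  · rw [← hGf, ← hGf]
    exact hGG i j hij
  · rw [← hGf]
    exact hD _ ⟨D, hDP, rfl⟩ (fun i h => hDF i (f.injective.image_injective h)) j

theorem HasImprovement.of_translatePacking {m : ℕ} {y : Euc d} {r : ℝ} {v : Euc d}
    (h : HasImprovement K m y r (translatePacking v P)) : HasImprovement K m (y - v) r P := by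
  have := h.of_image (IsometryEquiv.addRight v)
  rwa [sub_eq_add_neg]

theorem eventually_hyperfilter_one_div_le {ε : ℝ} (hε : 0 < ε) :
    ∀ᶠ n : ℕ in (hyperfilter ℕ : Filter ℕ), 1 / ((n : ℝ) + 1) ≤ ε :=
  (tendsto_one_div_add_atTop_nhds_zero_nat.eventually (ge_mem_nhds hε)).filter_mono
    Nat.hyperfilter_le_atTop

theorem eventually_hyperfilter_le_natCast (r : ℝ) :
    ∀ᶠ n : ℕ in (hyperfilter ℕ : Filter ℕ), r ≤ n :=
  (tendsto_natCast_atTop_atTop.eventually_ge_atTop r).filter_mono Nat.hyperfilter_le_atTop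

/-- Having no improvement of given size in a given ball is an open condition on packings. -/
theorem exists_forall_packingNear_not_hasImprovement (hK : IsBody K) (hne : K.Nonempty)
    (hQ : IsPacking K Q) {m : ℕ} {r : ℝ} (h : ¬ HasImprovement K m 0 r Q) :
    ∃ ρ ε : ℝ, 0 < ε ∧ ∀ P, IsPacking K P → PackingNear ρ ε P Q → ¬ HasImprovement K m 0 r P := by
  by_contra! hcon
  choose Ps hPs hnear F G hF hFr hG hGr hGG hDG using fun n : ℕ =>
    hcon n (1 / ((n : ℝ) + 1)) (by positivity)
  have hmeet : ∀ A : Set (Euc d), IsIsomCopy K A → A ⊆ closedBall 0 r →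
      (A ∩ closedBall 0 r).Nonempty := fun A hA h => by
    rw [Set.inter_eq_left.2 h]
    exact hA.nonempty hne
  let U : Ultrafilter ℕ := hyperfilter ℕ
  have hlim : ∀ (A : ℕ → Set (Euc d)) (B : Set (Euc d)),
      (∀ᶠ n in (U : Filter ℕ), hausdorffDist (A n) B ≤ 1 / ((n : ℝ) + 1)) →
      HausdorffTendsto U A B := fun A B h ε hε => by
    filter_upwards [h, eventually_hyperfilter_one_div_le hε] with n h1 h2
    exact h1.trans h2
  have hsub : ∀ (A : ℕ → Set (Euc d)) (B : Set (Euc d)),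
      (∀ᶠ n in (U : Filter ℕ), IsIsomCopy K (A n)) → IsIsomCopy K B →
      (∀ᶠ n in (U : Filter ℕ), A n ⊆ closedBall 0 r) → HausdorffTendsto U A B →
      B ⊆ closedBall 0 r := by
    intro A B hA hB hAr hAB x hx
    rw [mem_closedBall]
    refine le_of_forall_pos_le_add fun ε hε => ?_
    obtain ⟨n, h1, h2, h3⟩ := (hA.and (hAr.and (hAB (ε / 2) (by positivity)))).exists
    rw [hausdorffDist_comm] at h3
    obtain ⟨y, hy, hxy⟩ := hB.exists_dist_lt hK.1 hne h1 (lt_of_le_of_lt h3 (half_lt_self hε)) hx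
    have := h2 hy
    rw [mem_closedBall] at this
    linarith [dist_triangle x y 0]
  have hFlim : ∀ i, ∃ B ∈ Q, HausdorffTendsto U (fun n => F n i) B := by
    intro i
    have hfin := hQ.finite_meeting hK hne (isBounded_closedBall (x := (0 : Euc d)) (r := r + 2))
    have h1 : ∀ᶠ n in (U : Filter ℕ), ∃ B ∈ {B ∈ Q | (B ∩ closedBall 0 (r + 2)).Nonempty},
        hausdorffDist (F n i) B ≤ 1 / ((n : ℝ) + 1) := by
      filter_upwards [eventually_hyperfilter_le_natCast r] with n hn
      have hcopy := (hPs n).1 _ (hF n i)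
      have hmt := hmeet _ hcopy (hFr n i)
      obtain ⟨B, hB, hFB⟩ := (hnear n).1 _ (hF n i)
        (hmt.mono (Set.inter_subset_inter_right _ (closedBall_subset_closedBall hn)))
      refine ⟨B, ⟨hB, ?_⟩, hFB⟩
      obtain ⟨x, hx, hxr⟩ := hmt
      have h2 : 1 / ((n : ℝ) + 1) ≤ 1 := by
        rw [div_le_one (by positivity)]
        linarith [n.cast_nonneg (α := ℝ)]
      obtain ⟨y, hy, hxy⟩ := hcopy.exists_dist_lt hK.1 hne (hQ.1 B hB)
        (lt_of_le_of_lt (hFB.trans h2) one_lt_two) hx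
      refine ⟨y, hy, ?_⟩
      rw [mem_closedBall] at hxr ⊢
      have := dist_triangle y x 0
      rw [dist_comm y x] at this
      linarith
    obtain ⟨B, hB, hn⟩ := (Ultrafilter.eventually_exists_mem_iff hfin).1 h1
    exact ⟨B, hB.1, hlim _ _ hn⟩
  have hGlim : ∀ j, ∃ B, IsIsomCopy K B ∧ HausdorffTendsto U (fun n => G n j) B := fun j =>
    exists_isIsomCopy_hausdorffTendsto U hK.1 (r := r) (.of_forall fun n => hG n j)
      (.of_forall fun n => hmeet _ (hG n j) (hGr n j))
  choose F' hF' hFF' using hFlim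
  choose G' hG' hGG' using hGlim
  refine h ⟨F', G', hF', fun i => ?_, hG', fun j => ?_, fun i j hij => ?_, fun D hD hDF j => ?_⟩
  · exact hsub _ _ (.of_forall fun n => (hPs n).1 _ (hF n i)) (hQ.1 _ (hF' i))
      (.of_forall fun n => hFr n i) (hFF' i)
  · exact hsub _ _ (.of_forall fun n => hG n j) (hG' j) (.of_forall fun n => hGr n j) (hGG' j)
  · exact interior_inter_eq_empty_of_tendsto U hK.1 hne (.of_forall fun n => hG n i)
      (.of_forall fun n => hG n j) (hG' i) (hG' j) (hGG' i) (hGG' j)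
      (.of_forall fun n => hGG n i j hij)
  · obtain ⟨x, hx⟩ := (hQ.1 D hD).nonempty hne
    have h1 : ∀ n : ℕ, ∃ A, dist x 0 ≤ n → A ∈ Ps n ∧ hausdorffDist A D ≤ 1 / ((n : ℝ) + 1) := by
      intro n
      by_cases hn : dist x 0 ≤ n
      · obtain ⟨A, hA, hAD⟩ := (hnear n).2 D hD ⟨x, hx, hn⟩
        exact ⟨A, fun _ => ⟨hA, hAD⟩⟩
      · exact ⟨∅, fun h => (hn h).elim⟩
    choose A hA using h1
    have h2 := (eventually_hyperfilter_le_natCast (dist x 0)).mono hA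
    have hcopy : ∀ᶠ n in (U : Filter ℕ), IsIsomCopy K (A n) :=
      h2.mono fun n hn => (hPs n).1 _ hn.1
    have hAD : HausdorffTendsto U A D := hlim _ _ (h2.mono fun n hn => hn.2)
    have hneq : ∀ᶠ n in (U : Filter ℕ), ∀ i, A n ≠ F n i := by
      refine eventually_all.2 fun i => Ultrafilter.eventually_not.2 fun heq => hDF i ?_
      refine eq_of_hausdorffTendsto hK.1 hne hcopy (hQ.1 D hD) (hQ.1 _ (hF' i)) hAD fun ε hε => ?_
      filter_upwards [heq, hFF' i ε hε] with n h3 h4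
      rwa [h3]
    refine interior_inter_eq_empty_of_tendsto U hK.1 hne hcopy (.of_forall fun n => hG n j)
      (hQ.1 D hD) (hG' j) hAD (hGG' j) ?_
    filter_upwards [h2, hneq] with n h3 h4
    exact hDG n _ h3.1 h4 j

end Improvement

section Recurrence

variable {d : ℕ} {K : Set (Euc d)} {P : Set (Set (Euc d))}

theorem PackingNear.refl {r ε : ℝ} (hε : 0 ≤ ε) : PackingNear r ε P P :=
  ⟨fun A hA _ => ⟨A, hA, by simpa using hε⟩, fun A hA _ => ⟨A, hA, by simpa using hε⟩⟩

/-- In a uniformly recurrent packing every local pattern recurs with bounded gaps. -/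
theorem UniformlyRecurrent.exists_dist_le_packingNear (hK : IsBody K) (hne : K.Nonempty)
    (hP : IsPacking K P) (hur : UniformlyRecurrent K P) (v : Euc d) (r : ℝ) {ε : ℝ} (hε : 0 < ε) :
    ∃ R : ℝ, ∀ c, ∃ w, dist w c ≤ R ∧
      PackingNear r ε (translatePacking w P) (translatePacking v P) := by
  by_contra! hcon
  choose c hc using fun n : ℕ => hcon n
  obtain ⟨B, hB, hBlim⟩ := exists_isPacking_packingNear (hyperfilter ℕ) hK hne
    fun n => hP.translate (c n)
  have hBP : IsLimitOf B P := isLimitOf_of_forall_exists_packingNear hK hne hP hB fun r ε hε => by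
    obtain ⟨n, hn⟩ := (hBlim r ε hε).exists
    exact ⟨c n, hn⟩
  let η := min (ε / 2) (1 / 2)
  have hη : 0 < η := by positivity
  have hη1 : η < 1 := (min_le_right _ _).trans_lt one_half_lt_one
  have hηε : η + η ≤ ε := by linarith [min_le_left (ε / 2) (1 / 2 : ℝ)]
  obtain ⟨u, hu⟩ := (hur B hB hBP).exists_packingNear (r + 1 + ‖v‖) hη
  have h1 := hu.translate v
  rw [translatePacking_translatePacking] at h1
  obtain ⟨n, hn, hun⟩ := ((hBlim (r + 1 + ‖u + v‖) η hη).and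
    (eventually_hyperfilter_le_natCast ‖u + v‖)).exists
  have h2 := hn.translate (u + v)
  rw [translatePacking_translatePacking] at h2
  refine hc n (c n + (u + v)) (by simpa [dist_eq_norm] using hun) ?_
  exact ((h2.trans hK.1 hne (hP.translate _) (hB.translate _) (hP.translate _) hη1 hη1 h1)).mono
    le_rfl hηε

/-- A Baire category argument in the orbit closure of `P`. -/
theorem exists_completelySaturated_isLimitOf (hK : IsBody K) (hne : K.Nonempty)
    (hP : IsPacking K P)
    (hdense : ∀ (v : Euc d) (r ε : ℝ) (m k : ℕ), 0 < ε → ∃ w,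
      PackingNear r ε (translatePacking w P) (translatePacking v P) ∧
        ¬ HasImprovement K m 0 k (translatePacking w P)) :
    ∃ Q, IsPacking K Q ∧ CompletelySaturated K Q ∧ IsLimitOf Q P := by
  have step : ∀ (k : ℕ) (s : Euc d × ℝ × ℝ), ∃ s' : Euc d × ℝ × ℝ, 0 < s.2.2 →
      (0 < s'.2.2 ∧ s'.2.2 < 1) ∧
      (∀ Q, IsPacking K Q → PackingNear s'.2.1 s'.2.2 Q (translatePacking s'.1 P) →
        PackingNear s.2.1 s.2.2 Q (translatePacking s.1 P)) ∧
      ∀ Q, IsPacking K Q →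
        PackingNear (s'.2.1 - 1) (s'.2.2 + s'.2.2) Q (translatePacking s'.1 P) →
        ¬ HasImprovement K k.unpair.1 0 k.unpair.2 Q := by
    rintro k ⟨v, r, ε⟩
    by_cases hε : 0 < ε
    swap
    · exact ⟨0, fun h => (hε h).elim⟩
    let η := min (ε / 2) (1 / 2)
    have hη : 0 < η := by positivity
    have hη1 : η < 1 := (min_le_right _ _).trans_lt one_half_lt_one
    have hηε : η + η ≤ ε := by linarith [min_le_left (ε / 2) (1 / 2 : ℝ)]
    obtain ⟨w, hw, hwimp⟩ := hdense v (r + 1) η k.unpair.1 k.unpair.2 hη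
    obtain ⟨ρ, δ, hδ, hopen⟩ :=
      exists_forall_packingNear_not_hasImprovement hK hne (hP.translate w) hwimp
    refine ⟨(w, max (r + 1) (ρ + 1), min (δ / 2) η), fun _ =>
      ⟨⟨by positivity, (min_le_right _ _).trans_lt hη1⟩, fun Q hQ hnear => ?_,
        fun Q hQ hnear => hopen Q hQ (hnear.mono ?_ ?_)⟩⟩
    · exact ((hnear.mono (le_max_left _ _) (min_le_right _ _)).trans hK.1 hne hQ (hP.translate _)
        (hP.translate _) hη1 hη1 hw).mono le_rfl hηε
    · exact le_sub_iff_add_le.2 (le_max_right _ _)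
    · have := min_le_left (δ / 2) η
      change min (δ / 2) η + min (δ / 2) η ≤ δ
      linarith
  choose next hnext using step
  let s : ℕ → Euc d × ℝ × ℝ := fun n => Nat.rec (0, 0, 1) next n
  have hpos : ∀ n, 0 < (s n).2.2 := fun n => by
    induction n with
    | zero => exact one_pos
    | succ n ih => exact (hnext n (s n) ih).1.1
  have hmono : ∀ i j, i ≤ j → ∀ Q, IsPacking K Q →
      PackingNear (s j).2.1 (s j).2.2 Q (translatePacking (s j).1 P) →
      PackingNear (s i).2.1 (s i).2.2 Q (translatePacking (s i).1 P) := by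
    intro i j hij Q hQ
    induction j, hij using Nat.le_induction with
    | base => exact id
    | succ j _ ih => exact fun h => ih ((hnext j (s j) (hpos j)).2.1 Q hQ h)
  obtain ⟨Q, hQ, hlim⟩ := exists_isPacking_packingNear (hyperfilter ℕ) hK hne
    fun n => hP.translate (s n).1
  refine ⟨Q, hQ, completelySaturated_of_forall_not_hasImprovement hK.1 hQ fun m r => ?_,
    isLimitOf_of_forall_exists_packingNear hK hne hP hQ fun r ε hε => ?_⟩
  · let k := Nat.pair m r
    obtain ⟨⟨h0, h1⟩, -, h2⟩ := hnext k (s k) (hpos k)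
    change 0 < (s (k + 1)).2.2 at h0
    change (s (k + 1)).2.2 < 1 at h1
    obtain ⟨j, hj, hkj⟩ := ((hlim (s (k + 1)).2.1 _ h0).and
      ((eventually_ge_atTop (k + 1)).filter_mono Nat.hyperfilter_le_atTop)).exists
    have h3 := hmono _ _ hkj _ (hP.translate (s j).1) (.refl (hpos j).le)
    have h4 := PackingNear.trans (r := (s (k + 1)).2.1 - 1) hK.1 hne hQ (hP.translate _)
      (hP.translate _) h1 h1 (by rw [sub_add_cancel]; exact hj.symm)
      (by rw [sub_add_cancel]; exact h3)
    have h5 := h2 Q hQ h4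
    rwa [Nat.unpair_pair] at h5
  · obtain ⟨n, hn⟩ := (hlim r ε hε).exists
    exact ⟨_, hn⟩

end Recurrence

section Cubes

variable {d : ℕ} {K : Set (Euc d)} {P : Set (Set (Euc d))}

/-- The half-open cubes of side `L` in the standard cubical tiling. -/
def cube (L : ℝ) (z : Fin d → ℤ) : Set (Euc d) :=
  {x | ∀ i, L * z i ≤ x i ∧ x i < L * (z i + 1)}

theorem mem_cube_iff {L : ℝ} (hL : 0 < L) {z : Fin d → ℤ} {x : Euc d} :
    x ∈ cube L z ↔ ∀ i, ⌊x i / L⌋ = z i := by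
  refine forall_congr' fun i => ?_
  rw [Int.floor_eq_iff, le_div_iff₀ hL, div_lt_iff₀ hL, mul_comm L, mul_comm L]

theorem disjoint_cube {L : ℝ} (hL : 0 < L) {z w : Fin d → ℤ} (h : z ≠ w) :
    Disjoint (cube (d := d) L z) (cube L w) :=
  Set.disjoint_left.2 fun _ hz hw => h (funext fun i =>
    ((mem_cube_iff hL).1 hz i).symm.trans ((mem_cube_iff hL).1 hw i))

theorem volume_cube {L : ℝ} (hL : 0 < L) (z : Fin d → ℤ) :
    volume (cube (d := d) L z) = ENNReal.ofReal (L ^ d) := by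
  have h1 : cube (d := d) L z = WithLp.ofLp ⁻¹'
      (Set.univ.pi fun i => Set.Ico (L * z i) (L * (z i + 1))) := by
    ext x
    simp [cube]
  rw [h1, (PiLp.volume_preserving_ofLp (Fin d)).measure_preimage
    (MeasurableSet.univ_pi fun i => measurableSet_Ico).nullMeasurableSet, Real.volume_pi_Ico]
  simp [mul_add, ENNReal.ofReal_pow hL.le]

theorem measurableSet_cube {L : ℝ} (z : Fin d → ℤ) : MeasurableSet (cube (d := d) L z) := by
  have h1 : cube (d := d) L z = WithLp.ofLp ⁻¹'
      (Set.univ.pi fun i => Set.Ico (L * z i) (L * (z i + 1))) := by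
    ext x
    simp [cube]
  rw [h1]
  exact (PiLp.volume_preserving_ofLp (Fin d)).measurable
    (MeasurableSet.univ_pi fun i => measurableSet_Ico)

theorem dist_le_of_mem_cube {L : ℝ} {z : Fin d → ℤ} {x y : Euc d}
    (hx : x ∈ cube L z) (hy : y ∈ cube L z) : dist x y ≤ √(d * L ^ 2) := by
  rw [EuclideanSpace.dist_eq]
  refine Real.sqrt_le_sqrt ?_
  calc ∑ i, dist (x i) (y i) ^ 2 ≤ ∑ _i : Fin d, L ^ 2 := by
        refine Finset.sum_le_sum fun i _ => ?_
        have h1 := hx i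
        have h2 := hy i
        rw [Real.dist_eq, sq_abs]
        exact sq_le_sq' (by nlinarith) (by nlinarith)
    _ = d * L ^ 2 := by simp

theorem finite_cube_meeting {L : ℝ} (hL : 0 < L) {T : Set (Euc d)}
    (hT : Bornology.IsBounded T) : {z | (cube L z ∩ T).Nonempty}.Finite := by
  obtain ⟨R, hR⟩ := hT.subset_closedBall (0 : Euc d)
  refine (Set.finite_Icc (fun _ => ⌊-R / L⌋) (fun _ => ⌊R / L⌋)).subset ?_
  rintro z ⟨x, hx, hxT⟩
  have h1 : ∀ i, |x i| ≤ R := fun i => by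
    have h2 := hR hxT
    rw [mem_closedBall_zero_iff] at h2
    exact (PiLp.norm_apply_le x i).trans h2
  refine ⟨fun i => ?_, fun i => ?_⟩ <;> rw [← (mem_cube_iff hL).1 hx i] <;>
    refine Int.floor_le_floor (div_le_div_of_nonneg_right ?_ hL.le)
  · exact (abs_le.1 (h1 i)).1
  · exact (abs_le.1 (h1 i)).2

theorem subset_biUnion_cube {L : ℝ} (hL : 0 < L) {T : Set (Euc d)}
    (hT : Bornology.IsBounded T) : T ⊆ ⋃ z ∈ (finite_cube_meeting hL hT).toFinset, cube L z := by
  intro x hx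
  have h1 : x ∈ cube L fun i => ⌊x i / L⌋ := (mem_cube_iff hL).2 fun i => rfl
  exact Set.mem_biUnion (by simpa using ⟨x, h1, hx⟩) h1

theorem volume_biUnion_cube {L : ℝ} (hL : 0 < L) (Z : Finset (Fin d → ℤ)) :
    volume (⋃ z ∈ Z, cube (d := d) L z) = Z.card * ENNReal.ofReal (L ^ d) := by
  rw [measure_biUnion_finset (fun z _ w _ h => disjoint_cube hL h)
    fun z _ => measurableSet_cube z]
  simp [volume_cube hL]

theorem card_mul_le_of_meets {L : ℝ} (hL : 0 < L) {p : Euc d} {T : ℝ} (Z : Finset (Fin d → ℤ))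
    (hZ : ∀ z ∈ Z, (cube L z ∩ ball p T).Nonempty) :
    (Z.card : ℝ≥0∞) * ENNReal.ofReal (L ^ d) ≤ volume (ball p (T + √(d * L ^ 2))) := by
  rw [← volume_biUnion_cube hL]
  refine measure_mono (Set.iUnion₂_subset fun z hz x hx => ?_)
  obtain ⟨y, hy, hyp⟩ := hZ z hz
  rw [mem_ball] at hyp ⊢
  linarith [dist_triangle x y p, dist_le_of_mem_cube hx hy]

/-- An upper bound for the volume of `P` in each cube bounds the volume in balls. -/
theorem tsum_volume_inter_ball_le {L : ℝ} (hL : 0 < L) {a : ℝ≥0∞}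
    (ha : ∀ z, ∑' D : P, volume ((D : Set (Euc d)) ∩ cube L z) ≤ a) (p : Euc d) (T : ℝ) :
    (∑' D : P, volume ((D : Set (Euc d)) ∩ ball p T)) * ENNReal.ofReal (L ^ d) ≤
      volume (ball p (T + √(d * L ^ 2))) * a := by
  set Z := (finite_cube_meeting hL (isBounded_ball (x := p) (r := T))).toFinset
  have h1 : ∑' D : P, volume ((D : Set (Euc d)) ∩ ball p T) ≤ Z.card * a := by
    calc ∑' D : P, volume ((D : Set (Euc d)) ∩ ball p T)
        ≤ ∑' D : P, ∑ z ∈ Z, volume ((D : Set (Euc d)) ∩ cube L z) := by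
          refine ENNReal.tsum_le_tsum fun D => ?_
          refine (measure_mono ?_).trans (measure_biUnion_finset_le Z _)
          rw [← Set.inter_iUnion₂]
          exact Set.inter_subset_inter_right _ (subset_biUnion_cube hL isBounded_ball)
      _ = ∑ z ∈ Z, ∑' D : P, volume ((D : Set (Euc d)) ∩ cube L z) :=
          Summable.tsum_finsetSum fun _ _ => ENNReal.summable
      _ ≤ ∑ z ∈ Z, a := Finset.sum_le_sum fun z _ => ha z
      _ = Z.card * a := by simp
  calc _ ≤ (Z.card * a) * ENNReal.ofReal (L ^ d) := by gcongr
    _ = (Z.card * ENNReal.ofReal (L ^ d)) * a := by ring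
    _ ≤ _ := by
      gcongr
      exact card_mul_le_of_meets hL Z fun z hz => by simpa [Z] using hz

/-- A lower bound for the volume of `P` in each cube bounds the volume in balls. -/
theorem le_tsum_volume_inter_ball {L : ℝ} (hL : 0 < L) {a : ℝ≥0∞}
    (hP : ∀ D ∈ P, MeasurableSet D)
    (ha : ∀ z, a ≤ ∑' D : P, volume ((D : Set (Euc d)) ∩ cube L z)) (p : Euc d) (T : ℝ) :
    volume (ball p (T - √(d * L ^ 2))) * a ≤
      (∑' D : P, volume ((D : Set (Euc d)) ∩ ball p T)) * ENNReal.ofReal (L ^ d) := by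
  set Z := (finite_cube_meeting hL
    (isBounded_ball (x := p) (r := T - √(d * L ^ 2)))).toFinset with hZ
  have h1 : Z.card * a ≤ ∑' D : P, volume ((D : Set (Euc d)) ∩ ball p T) := by
    calc (Z.card * a : ℝ≥0∞) = ∑ z ∈ Z, a := by simp
      _ ≤ ∑ z ∈ Z, ∑' D : P, volume ((D : Set (Euc d)) ∩ cube L z) :=
        Finset.sum_le_sum fun z _ => ha z
      _ = ∑' D : P, ∑ z ∈ Z, volume ((D : Set (Euc d)) ∩ cube L z) :=
          (Summable.tsum_finsetSum fun _ _ => ENNReal.summable).symm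
      _ ≤ _ := by
        refine ENNReal.tsum_le_tsum fun D => ?_
        rw [← measure_biUnion_finset (fun z _ w _ h => (disjoint_cube hL h).mono
          Set.inter_subset_right Set.inter_subset_right)
          fun z _ => (hP D D.2).inter (measurableSet_cube z), ← Set.inter_iUnion₂]
        refine measure_mono (Set.inter_subset_inter_right _
          (Set.iUnion₂_subset fun z hz x hx => ?_))
        obtain ⟨y, hy, hyp⟩ : (cube L z ∩ ball p (T - √(d * L ^ 2))).Nonempty := by
          simpa [Z] using hz
        rw [mem_ball] at hyp ⊢
        linarith [dist_triangle x y p, dist_le_of_mem_cube hx hy]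
  calc _ ≤ (Z.card * ENNReal.ofReal (L ^ d)) * a := by
        gcongr
        rw [← volume_biUnion_cube hL]
        exact measure_mono (subset_biUnion_cube hL isBounded_ball)
    _ = (Z.card * a) * ENNReal.ofReal (L ^ d) := by ring
    _ ≤ _ := by gcongr

theorem toReal_volume_ball (p : Euc d) {r : ℝ} (hr : 0 < r) :
    (volume (ball p r)).toReal = r ^ d * (volume (ball (0 : Euc d) 1)).toReal := by
  have := Measure.addHaar_ball_of_pos (volume : Measure (Euc d)) p hr
  rw [finrank_euclideanSpace_fin] at this
  rw [this, ENNReal.toReal_mul, ENNReal.toReal_ofReal (by positivity)]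

theorem tsum_volume_inter_ball_ne_top {L : ℝ} (hL : 0 < L) {a : ℝ}
    (ha : ∀ z, ∑' D : P, volume ((D : Set (Euc d)) ∩ cube L z) ≤ ENNReal.ofReal a)
    (p : Euc d) (T : ℝ) : ∑' D : P, volume ((D : Set (Euc d)) ∩ ball p T) ≠ ⊤ := by
  intro h
  have h1 := tsum_volume_inter_ball_le hL ha p T
  rw [h, ENNReal.top_mul (by simpa using pow_pos hL d)] at h1
  exact (ENNReal.mul_lt_top measure_ball_lt_top ENNReal.ofReal_lt_top).not_ge h1

theorem ballFrac_le {L : ℝ} (hL : 0 < L) {a : ℝ} (ha0 : 0 ≤ a)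
    (ha : ∀ z, ∑' D : P, volume ((D : Set (Euc d)) ∩ cube L z) ≤ ENNReal.ofReal a)
    (p : Euc d) {T : ℝ} (hT : 0 < T) :
    ballFrac P p T ≤ a / L ^ d * ((T + √(d * L ^ 2)) / T) ^ d := by
  have hc : 0 < (volume (ball (0 : Euc d) 1)).toReal :=
    ENNReal.toReal_pos (measure_ball_pos _ _ one_pos).ne' measure_ball_lt_top.ne
  have h1 := ENNReal.toReal_mono
    (ENNReal.mul_lt_top measure_ball_lt_top ENNReal.ofReal_lt_top).ne
    (tsum_volume_inter_ball_le hL ha p T)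
  rw [ENNReal.toReal_mul, ENNReal.toReal_mul, toReal_volume_ball p (by positivity),
    ENNReal.toReal_ofReal ha0, ENNReal.toReal_ofReal (by positivity)] at h1
  rw [ballFrac, ENNReal.toReal_div, toReal_volume_ball p hT, div_pow, div_mul_div_comm,
    div_le_div_iff₀ (by positivity) (by positivity)]
  nlinarith [mul_le_mul_of_nonneg_right h1 (pow_pos hT d).le]

theorem le_ballFrac {L : ℝ} (hL : 0 < L) (hP : ∀ D ∈ P, MeasurableSet D) {a : ℝ} (ha0 : 0 ≤ a)
    (ha : ∀ z, ∑' D : P, volume ((D : Set (Euc d)) ∩ cube L z) = ENNReal.ofReal a)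
    (p : Euc d) {T : ℝ} (hT : √(d * L ^ 2) < T) :
    a / L ^ d * ((T - √(d * L ^ 2)) / T) ^ d ≤ ballFrac P p T := by
  have hT0 : 0 < T := (Real.sqrt_nonneg _).trans_lt hT
  have hc : 0 < (volume (ball (0 : Euc d) 1)).toReal :=
    ENNReal.toReal_pos (measure_ball_pos _ _ one_pos).ne' measure_ball_lt_top.ne
  have h1 := ENNReal.toReal_mono
    (ENNReal.mul_ne_top (tsum_volume_inter_ball_ne_top hL (fun z => (ha z).le) p T)
      ENNReal.ofReal_ne_top)
    (le_tsum_volume_inter_ball hL hP (fun z => (ha z).ge) p T)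
  rw [ENNReal.toReal_mul, ENNReal.toReal_mul, toReal_volume_ball p (sub_pos.2 hT),
    ENNReal.toReal_ofReal ha0, ENNReal.toReal_ofReal (by positivity)] at h1
  rw [ballFrac, ENNReal.toReal_div, toReal_volume_ball p hT0, div_pow, div_mul_div_comm,
    div_le_div_iff₀ (by positivity) (by positivity)]
  nlinarith [mul_le_mul_of_nonneg_right h1 (pow_pos hT0 d).le]

theorem tendsto_mul_add_div_pow (b s : ℝ) (n : ℕ) :
    Tendsto (fun T : ℝ => b * ((T + s) / T) ^ n) atTop (nhds b) := by
  have h1 : Tendsto (fun T : ℝ => b * (1 + s / T) ^ n) atTop (nhds (b * (1 + 0) ^ n)) :=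
    ((tendsto_const_nhds.add (tendsto_const_nhds.div_atTop tendsto_id)).pow n).const_mul b
  rw [add_zero, one_pow, mul_one] at h1
  refine h1.congr' ?_
  filter_upwards [eventually_gt_atTop 0] with T hT
  rw [add_div, div_self hT.ne']

theorem HasDensity.le_of_cube {δ : ℝ} (h : HasDensity P δ) {L : ℝ} (hL : 0 < L) {a : ℝ}
    (ha0 : 0 ≤ a)
    (ha : ∀ z, ∑' D : P, volume ((D : Set (Euc d)) ∩ cube L z) ≤ ENNReal.ofReal a) :
    δ ≤ a / L ^ d := by
  refine le_of_tendsto_of_tendsto (h 0) (tendsto_mul_add_div_pow (a / L ^ d) √(d * L ^ 2) d) ?_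
  filter_upwards [eventually_gt_atTop 0] with T hT
  exact ballFrac_le hL ha0 ha 0 hT

theorem hasDensity_of_cube {L : ℝ} (hL : 0 < L) (hP : ∀ D ∈ P, MeasurableSet D) {a : ℝ}
    (ha0 : 0 ≤ a)
    (ha : ∀ z, ∑' D : P, volume ((D : Set (Euc d)) ∩ cube L z) = ENNReal.ofReal a) :
    HasDensity P (a / L ^ d) := by
  intro p
  refine tendsto_of_tendsto_of_tendsto_of_le_of_le'
    (tendsto_mul_add_div_pow (a / L ^ d) (-√(d * L ^ 2)) d)
    (tendsto_mul_add_div_pow (a / L ^ d) √(d * L ^ 2) d) ?_ ?_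
  · filter_upwards [eventually_gt_atTop √(d * L ^ 2)] with T hT
    rw [← sub_eq_add_neg]
    exact le_ballFrac hL hP ha0 ha p hT
  · filter_upwards [eventually_gt_atTop 0] with T hT
    exact ballFrac_le hL ha0 (fun z => (ha z).le) p hT

end Cubes

section Density

variable {d : ℕ} {K : Set (Euc d)} {P : Set (Set (Euc d))}

theorem isBounded_cube {L : ℝ} (z : Fin d → ℤ) : Bornology.IsBounded (cube (d := d) L z) :=
  isBounded_iff.2 ⟨_, fun _ hx _ hy => dist_le_of_mem_cube hx hy⟩

theorem IsBody.volume_ne_top (hK : IsBody K) : volume K ≠ ⊤ := hK.1.measure_lt_top.ne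

theorem IsBody.toReal_volume_interior_pos (hK : IsBody K) (hne : K.Nonempty) :
    0 < (volume (interior K)).toReal :=
  ENNReal.toReal_pos (isOpen_interior.measure_pos _ (hK.interior_nonempty hne)).ne'
    (measure_ne_top_of_subset interior_subset hK.volume_ne_top)

theorem tsum_volume_inter_eq_sum {T : Set (Euc d)} {S : Finset (Set (Euc d))}
    (hS : (S : Set (Set (Euc d))) ⊆ P) (hT : ∀ D ∈ P, (D ∩ T).Nonempty → D ∈ S) :
    ∑' D : P, volume ((D : Set (Euc d)) ∩ T) = ∑ D ∈ S, volume (D ∩ T) := by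
  rw [tsum_subtype P fun D => volume (D ∩ T), tsum_eq_sum (s := S)]
  · exact Finset.sum_congr rfl fun D hD => Set.indicator_of_mem (hS hD) _
  · intro D hD
    refine Set.indicator_apply_eq_zero.2 fun hDP => ?_
    rw [Set.not_nonempty_iff_eq_empty.1 (mt (hT D hDP) hD), measure_empty]

theorem IsPacking.tsum_volume_inter_le (hK : IsBody K) (hP : IsPacking K P) {T : Set (Euc d)}
    (hfin : {D ∈ P | (D ∩ T).Nonempty}.Finite) :
    ∑' D : P, volume ((D : Set (Euc d)) ∩ T) ≤
      ENNReal.ofReal (hfin.toFinset.card * (volume K).toReal) := by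
  rw [ENNReal.ofReal_mul (Nat.cast_nonneg _), ENNReal.ofReal_natCast,
    ENNReal.ofReal_toReal hK.volume_ne_top,
    tsum_volume_inter_eq_sum (S := hfin.toFinset) (fun D hD => by simp_all)
    (fun D hD h => by simp_all), ← nsmul_eq_mul]
  refine Finset.sum_le_card_nsmul _ _ _ fun D hD => ?_
  rw [← (hP.1 D (by simp_all)).volume_eq]
  exact measure_mono Set.inter_subset_left

theorem IsPacking.card_mul_volume_interior_le {E : Finset (Set (Euc d))} {B : Set (Euc d)}
    (hE : IsPacking K (E : Set (Set (Euc d)))) (hB : ∀ D ∈ E, D ⊆ B) :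
    E.card * volume (interior K) ≤ volume B := by
  calc E.card * volume (interior K) = ∑ D ∈ E, volume (interior D) := by
        rw [Finset.sum_congr rfl fun D hD => (hE.1 D hD).volume_interior_eq]
        simp
    _ = volume (⋃ D ∈ E, interior D) :=
        (measure_biUnion_finset (fun D hD D' hD' h => Set.disjoint_iff_inter_eq_empty.2
          (hE.2 hD hD' h)) fun D _ => isOpen_interior.measurableSet).symm
    _ ≤ volume B := measure_mono (Set.iUnion₂_subset fun D hD => interior_subset.trans (hB D hD))

theorem bddAbove_density (hK : IsBody K) (hne : K.Nonempty) :
    BddAbove {δ : ℝ | ∃ P, IsPacking K P ∧ HasDensity P δ} := by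
  set ρ := √(d * (1 : ℝ) ^ 2) + diam K
  set N := (volume (closedBall (0 : Euc d) ρ)).toReal / (volume (interior K)).toReal
  have hpos := hK.toReal_volume_interior_pos hne
  refine ⟨N * (volume K).toReal / 1 ^ d, ?_⟩
  rintro δ ⟨P, hP, hδ⟩
  refine hδ.le_of_cube one_pos (by positivity) fun z => ?_
  have hfin := hP.finite_meeting hK hne (isBounded_cube (L := 1) z)
  refine (hP.tsum_volume_inter_le hK hfin).trans (ENNReal.ofReal_le_ofReal ?_)
  have hmem : ∀ D ∈ hfin.toFinset, D ∈ P ∧ (D ∩ cube 1 z).Nonempty := fun D hD => by simpa using hD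
  have hcard : (hfin.toFinset.card : ℝ) ≤ N := by
    rw [le_div_iff₀ hpos]
    set y : Euc d := WithLp.toLp 2 fun i => (1 : ℝ) * z i
    have hy : y ∈ cube 1 z := fun i => by simp [y]
    have h1 := (hP.subset (Q := hfin.toFinset) fun D hD => (hmem D hD).1)
      |>.card_mul_volume_interior_le (B := closedBall y ρ) fun D hD x hx => by
        obtain ⟨u, hu, huz⟩ := (hmem D hD).2
        rw [mem_closedBall]
        linarith [dist_triangle x u y, dist_le_of_mem_cube huz hy,
          (hP.1 D (hmem D hD).1).dist_le hK.1 hx hu]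
    rw [Measure.addHaar_closedBall_center] at h1
    have h2 := ENNReal.toReal_mono measure_closedBall_lt_top.ne h1
    rwa [ENNReal.toReal_mul, ENNReal.toReal_natCast] at h2
  gcongr

/-- Translation by a vector of the lattice of period `L`. -/
def latticeShift (L : ℝ) (z : Fin d → ℤ) : Euc d ≃ᵢ Euc d :=
  IsometryEquiv.addRight (WithLp.toLp 2 fun i => L * z i)

theorem latticeShift_image_subset {L : ℝ} {D : Set (Euc d)} (hD : D ⊆ cube L 0)
    (z : Fin d → ℤ) : latticeShift L z '' D ⊆ cube L z := by
  rintro _ ⟨x, hx, rfl⟩ i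
  have := hD hx i
  simp only [Pi.zero_apply, Int.cast_zero, mul_zero, zero_add, mul_one] at this
  simp only [latticeShift, IsometryEquiv.addRight_apply, PiLp.add_apply]
  constructor <;> linarith

/-- Repeating a finite packing in a cube periodically gives a lower bound for the packing
density. -/
theorem IsPacking.card_mul_volume_le_of_subset_cube (hK : IsBody K) (hne : K.Nonempty)
    {E : Finset (Set (Euc d))} (hE : IsPacking K (E : Set (Set (Euc d)))) {L : ℝ} (hL : 0 < L)
    (hcube : ∀ D ∈ E, D ⊆ cube L 0) :
    E.card * (volume K).toReal ≤ packingDensity K * L ^ d := by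
  set Q : Set (Set (Euc d)) := {D | ∃ z, ∃ D' ∈ E, latticeShift L z '' D' = D} with hQdef
  have hQ : IsPacking K Q := by
    constructor
    · rintro _ ⟨z, D, hD, rfl⟩
      exact (hE.1 D hD).image _
    · rintro _ ⟨z, D, hD, rfl⟩ _ ⟨w, D', hD', rfl⟩ h
      rcases eq_or_ne z w with rfl | hzw
      · exact (hE.image (latticeShift L z)).2 ⟨D, hD, rfl⟩ ⟨D', hD', rfl⟩ h
      · exact ((disjoint_cube hL hzw).mono
          (interior_subset.trans (latticeShift_image_subset (hcube D hD) z))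
          (interior_subset.trans (latticeShift_image_subset (hcube D' hD') w))).inter_eq
  have hsum : ∀ z, ∑' D : Q, volume ((D : Set (Euc d)) ∩ cube L z) =
      ENNReal.ofReal (E.card * (volume K).toReal) := fun z => by
    classical
    rw [tsum_volume_inter_eq_sum (S := E.image fun D => latticeShift L z '' D)]
    · rw [Finset.sum_image fun D _ D' _ h => (latticeShift L z).injective.image_injective h,
        Finset.sum_congr rfl fun D hD => by
          rw [Set.inter_eq_left.2 (latticeShift_image_subset (hcube D hD) z),
            volume_image_isometryEquiv, (hE.1 D hD).volume_eq]]
      rw [Finset.sum_const, nsmul_eq_mul, ENNReal.ofReal_mul (Nat.cast_nonneg _),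
        ENNReal.ofReal_natCast, ENNReal.ofReal_toReal hK.volume_ne_top]
    · intro D hD
      obtain ⟨D', hD', rfl⟩ := Finset.mem_image.1 hD
      exact ⟨z, D', hD', rfl⟩
    · rintro _ ⟨w, D, hD, rfl⟩ ⟨x, hx, hxz⟩
      obtain rfl : w = z := by
        by_contra h
        exact Set.disjoint_left.1 (disjoint_cube hL h)
          (latticeShift_image_subset (hcube D hD) w hx) hxz
      exact Finset.mem_image_of_mem _ hD
  have h1 := le_csSup (bddAbove_density hK hne) ⟨Q, hQ, hasDensity_of_cube hL
    (fun D hD => ((hQ.1 D hD).isCompact hK.1).measurableSet) (by positivity) hsum⟩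
  exact (div_le_iff₀ (by positivity)).1 h1

theorem IsPacking.card_mul_volume_le (hK : IsBody K) (hne : K.Nonempty)
    {E : Finset (Set (Euc d))} (hE : IsPacking K (E : Set (Set (Euc d)))) {L : ℝ} (hL : 0 < L)
    (v : Fin d → ℝ) (hv : ∀ D ∈ E, ∀ x ∈ D, ∀ i, v i ≤ x i ∧ x i < v i + L) :
    E.card * (volume K).toReal ≤ packingDensity K * L ^ d := by
  classical
  set f : Euc d ≃ᵢ Euc d := IsometryEquiv.addRight (-WithLp.toLp 2 v)
  rw [← Finset.card_image_of_injective E f.injective.image_injective]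
  refine IsPacking.card_mul_volume_le_of_subset_cube hK hne ?_ hL ?_
  · rw [Finset.coe_image]
    exact hE.image f
  · intro D hD
    obtain ⟨D', hD', rfl⟩ := Finset.mem_image.1 hD
    rintro _ ⟨x, hx, rfl⟩ i
    have := hv D' hD' x hx i
    simp only [Pi.zero_apply, Int.cast_zero, mul_zero, zero_add, mul_one, f,
      IsometryEquiv.addRight_apply, PiLp.add_apply, PiLp.neg_apply]
    constructor <;> linarith

/-- Improvements in disjoint balls can be carried out simultaneously. -/
theorem exists_card_add_le_of_hasImprovement (hK : IsBody K) (hne : K.Nonempty)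
    (hP : IsPacking K P) {E : Finset (Set (Euc d))} (hE : (E : Set (Set (Euc d))) ⊆ P)
    {J : Type*} [Fintype J] {m : ℕ} {r : ℝ} (y : J → Euc d)
    (hy : Pairwise fun i j => Disjoint (closedBall (y i) r) (closedBall (y j) r))
    (himp : ∀ j, HasImprovement K m (y j) r P) :
    ∃ E' : Finset (Set (Euc d)), IsPacking K (E' : Set (Set (Euc d))) ∧
      E.card + Fintype.card J ≤ E'.card ∧
      ∀ D ∈ E', D ∈ E ∨ ∃ j, D ⊆ closedBall (y j) r := by
  classical
  choose F G hFP hFr hG hGr hGG hPG using himp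
  set A := Finset.univ.image fun p : J × Fin m => F p.1 p.2
  set B := Finset.univ.image fun p : J × Fin (m + 1) => G p.1 p.2
  have hGdisj : ∀ p q : J × Fin (m + 1), p ≠ q →
      interior (G p.1 p.2) ∩ interior (G q.1 q.2) = ∅ := by
    rintro ⟨i, a⟩ ⟨j, b⟩ h
    rcases eq_or_ne i j with rfl | hij
    · exact hGG i a b fun hab => h (by rw [hab])
    · exact ((hy hij).mono (interior_subset.trans (hGr i a))
        (interior_subset.trans (hGr j b))).inter_eq
  have hEG : ∀ D ∈ E \ A, ∀ p : J × Fin (m + 1), interior D ∩ interior (G p.1 p.2) = ∅ := by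
    intro D hD p
    rw [Finset.mem_sdiff] at hD
    refine hPG p.1 D (hE hD.1) (fun i h => hD.2 ?_) p.2
    exact Finset.mem_image.2 ⟨(p.1, i), Finset.mem_univ _, h.symm⟩
  have hGne : ∀ p : J × Fin (m + 1), (interior (G p.1 p.2)).Nonempty := fun p =>
    (hG p.1 p.2).interior_nonempty hK hne
  have hinj : Function.Injective fun p : J × Fin (m + 1) => G p.1 p.2 := by
    intro p q h
    by_contra hpq
    have h1 := hGdisj p q hpq
    simp only at h
    rw [← h, Set.inter_self] at h1
    exact (hGne p).ne_empty h1
  have hdisj : Disjoint (E \ A) B := by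
    rw [Finset.disjoint_left]
    intro D hD hDB
    obtain ⟨p, -, rfl⟩ := Finset.mem_image.1 hDB
    have h1 := hEG _ hD p
    rw [Set.inter_self] at h1
    exact (hGne p).ne_empty h1
  refine ⟨(E \ A) ∪ B, ⟨?_, ?_⟩, ?_, ?_⟩
  · intro D hD
    rcases Finset.mem_union.1 hD with h | h
    · exact hP.1 D (hE (Finset.mem_sdiff.1 h).1)
    · obtain ⟨p, -, rfl⟩ := Finset.mem_image.1 h
      exact hG p.1 p.2
  · intro D hD D' hD' hne'
    rcases Finset.mem_union.1 hD with h | h <;> rcases Finset.mem_union.1 hD' with h' | h'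
    · exact hP.2 (hE (Finset.mem_sdiff.1 h).1) (hE (Finset.mem_sdiff.1 h').1) hne'
    · obtain ⟨p, -, rfl⟩ := Finset.mem_image.1 h'
      exact hEG D h p
    · obtain ⟨p, -, rfl⟩ := Finset.mem_image.1 h
      rw [Set.inter_comm]
      exact hEG D' h' p
    · obtain ⟨p, -, rfl⟩ := Finset.mem_image.1 h
      obtain ⟨q, -, rfl⟩ := Finset.mem_image.1 h'
      exact hGdisj p q fun hpq => hne' (by rw [hpq])
  · have h1 : A.card ≤ Fintype.card J * m := Finset.card_image_le.trans_eq (by simp)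
    have h2 : B.card = Fintype.card J * (m + 1) :=
      (Finset.card_image_of_injective _ hinj).trans (by simp)
    have h3 := Finset.le_card_sdiff A E
    rw [Finset.card_union_of_disjoint hdisj, h2, mul_add]
    omega
  · intro D hD
    rcases Finset.mem_union.1 hD with h | h
    · exact Or.inl (Finset.mem_sdiff.1 h).1
    · obtain ⟨p, -, rfl⟩ := Finset.mem_image.1 h
      exact Or.inr ⟨p.1, hGr p.1 p.2⟩

theorem exists_closedBall_subset_cube {p : Euc d → Prop} {R r : ℝ}
    (h : ∀ c, ∃ y, dist y c ≤ R ∧ p y) {M : ℝ} (hM : 2 * (R + r) < M) (w : Fin d → ℤ) :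
    ∃ y, closedBall y r ⊆ cube M w ∧ p y := by
  set c : Euc d := WithLp.toLp 2 fun i => M * (w i + 1 / 2)
  obtain ⟨y, hy, hpy⟩ := h c
  refine ⟨y, fun x hx i => ?_, hpy⟩
  have h1 : |x i - M * (w i + 1 / 2)| ≤ r + R := by
    have h2 := PiLp.norm_apply_le (x - c) i
    rw [← dist_eq_norm] at h2
    have h3 := dist_triangle x y c
    rw [mem_closedBall] at hx
    refine le_trans (by simpa [c] using h2) (by linarith)
  rw [abs_le] at h1
  constructor <;> linarith

theorem cube_mul_add_subset {M : ℝ} (hM : 0 < M) {k : ℕ} (z : Fin d → ℤ) (j : Fin d → Fin k) :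
    cube (d := d) M (fun i => k * z i + j i) ⊆ cube (k * M) z := by
  intro x hx i
  have h1 := hx i
  have h2 : ((j i : ℕ) : ℝ) + 1 ≤ k := by exact_mod_cast (j i).2
  push_cast at h1
  constructor
  · nlinarith [mul_nonneg hM.le (Nat.cast_nonneg (α := ℝ) (j i : ℕ))]
  · nlinarith [mul_le_mul_of_nonneg_left h2 hM.le]

/-- A packing of maximal density has no syndetic set of improvements. -/
theorem HasDensity.exists_forall_not_hasImprovement (hK : IsBody K) (hne : K.Nonempty)
    (hP : IsPacking K P) (hd : HasDensity P (packingDensity K)) (R r : ℝ) (m : ℕ) :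
    ∃ c, ∀ y, dist y c ≤ R → ¬ HasImprovement K m y r P := by
  by_contra! hcon
  set M := 2 * (|R| + |r|) + 1
  have hM : 0 < M := by positivity
  choose y hycube hyimp using exists_closedBall_subset_cube (r := r) (M := M) hcon (by
    simp only [M]
    linarith [le_abs_self R, le_abs_self r])
  set δ := packingDensity K
  set b := diam K
  have hb : 0 ≤ b := diam_nonneg
  have hvol : 0 < (volume K).toReal := (hK.toReal_volume_interior_pos hne).trans_le
    (ENNReal.toReal_mono hK.volume_ne_top (measure_mono interior_subset))
  have htends : Tendsto (fun k : ℕ => (k : ℝ) * M) atTop atTop :=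
    tendsto_natCast_atTop_atTop.atTop_mul_const hM
  have hev := ((tendsto_mul_add_div_pow δ (2 * b) d).comp htends).eventually_lt_const
    (u := δ + (volume K).toReal / M ^ d) (lt_add_of_pos_right _ (by positivity))
  obtain ⟨k, hk, hk0⟩ := (hev.and (eventually_gt_atTop 0)).exists
  have hkpos : (0 : ℝ) < k := by exact_mod_cast hk0
  set L := (k : ℝ) * M with hLdef
  have hL : 0 < L := by positivity
  set a := δ * (L + 2 * b) ^ d - k ^ d * (volume K).toReal with hadef
  have key : ∀ z : Fin d → ℤ, ((hP.finite_meeting hK hne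
      (isBounded_cube (L := L) z)).toFinset.card : ℝ) * (volume K).toReal ≤ a := by
    intro z
    set E := (hP.finite_meeting hK hne (isBounded_cube (L := L) z)).toFinset with hEdef
    have hmem : ∀ D ∈ E, D ∈ P ∧ (D ∩ cube L z).Nonempty := fun D hD => by simpa [E] using hD
    set w : (Fin d → Fin k) → Fin d → ℤ := fun j i => k * z i + j i
    have hw : Function.Injective w := fun j j' h => funext fun i => by
      have := congrFun h i
      simp only [w] at this
      exact Fin.ext (by omega)
    obtain ⟨E', hE', hcard, hsub⟩ := exists_card_add_le_of_hasImprovement hK hne hP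
      (fun D hD => (hmem D hD).1) (fun j => y (w j))
      (fun i j hij => (disjoint_cube hM (hw.ne hij)).mono (hycube _) (hycube _))
      (fun j => hyimp (w j))
    have h1 := hE'.card_mul_volume_le hK hne (L := L + 2 * b) (by positivity)
      (fun i => L * z i - b) (fun D hD x hx i => by
        rcases hsub D hD with h | ⟨j, hj⟩
        · obtain ⟨u, hu, huz⟩ := (hmem D h).2
          have h2 := PiLp.norm_apply_le (x - u) i
          rw [← dist_eq_norm] at h2
          have h3 : |x i - u i| ≤ b := by
            simpa using h2.trans ((hP.1 D (hmem D h).1).dist_le hK.1 hx hu)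
          rw [abs_le] at h3
          have h4 := huz i
          constructor <;> linarith
        · have h4 := cube_mul_add_subset hM z j (hycube _ (hj hx)) i
          constructor <;> linarith)
    have h2 : (E.card : ℝ) + (k : ℝ) ^ d ≤ E'.card := by
      have : E.card + k ^ d ≤ E'.card := by simpa using hcard
      exact_mod_cast this
    rw [hadef]
    nlinarith [mul_le_mul_of_nonneg_right h2 hvol.le]
  have ha0 : 0 ≤ a := le_trans (by positivity) (key 0)
  have h1 := hd.le_of_cube hL ha0 fun z =>
    (hP.tsum_volume_inter_le hK (hP.finite_meeting hK hne (isBounded_cube z))).trans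
      (ENNReal.ofReal_le_ofReal (key z))
  have hLd : 0 < L ^ d := by positivity
  have h2 : δ * (L + 2 * b) ^ d < (δ + (volume K).toReal / M ^ d) * L ^ d := by
    have : δ * ((L + 2 * b) / L) ^ d < δ + (volume K).toReal / M ^ d := hk
    rwa [div_pow, ← mul_div_assoc, div_lt_iff₀ hLd] at this
  have h3 : (volume K).toReal / M ^ d * L ^ d = k ^ d * (volume K).toReal := by
    rw [hLdef, mul_pow]
    field_simp
  rw [le_div_iff₀ hLd] at h1
  linarith

theorem completelySaturated_singleton_empty : CompletelySaturated (∅ : Set (Euc d)) {∅} := by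
  rintro n hn ⟨F, G, hF, hFn, hGn, hdisj, hpack⟩
  have hG : G ⊆ {∅} := fun D hD => by
    obtain ⟨f, rfl⟩ := hpack.1 D (Or.inr hD)
    simp
  have h1 := Finset.card_le_card hG
  rw [Finset.card_singleton] at h1
  obtain rfl : n = 1 := by omega
  have hF0 : F = ∅ := Finset.card_eq_zero.1 hFn
  obtain ⟨D, rfl⟩ := Finset.card_eq_one.1 hGn
  have hD : D = ∅ := by simpa using hG
  simp [hF0, hD] at hdisj

theorem isLimitOf_of_forall_eq_empty {A B : Set (Set (Euc d))} (hA : ∀ D ∈ A, D = ∅)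
    (hB : ∀ D ∈ B, D = ∅) : IsLimitOf A B := by
  refine ⟨fun _ => 0, fun ε _ => Eventually.of_forall fun n =>
    ⟨fun _ _ => False, fun _ _ h => h.elim, ?_, ?_⟩⟩
  · rintro _ ⟨D, hD, rfl⟩ h
    simp [hB D hD] at h
  · rintro D hD h
    simp [hA D hD] at h

end Density

/-- If `K ⊂ ℝ^d` is a self-nesting body, then every uniformly
recurrent dense packing `P` of `K` is limit-equivalent to a completely saturated
packing. -/
theorem uniformly_recurrent_dense_limit_equivalent_to_completely_saturated
    {d : ℕ} (K : Set (Euc d)) (hK : IsBody K) (hsn : SelfNests K)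
    (P : Set (Set (Euc d))) (hP : IsPacking K P)
    (hur : UniformlyRecurrent K P)
    (hd : HasDensity P (packingDensity K)) :
    ∃ Q : Set (Set (Euc d)), IsPacking K Q ∧ CompletelySaturated K Q ∧
      IsLimitOf Q P ∧ IsLimitOf P Q := by
  rcases K.eq_empty_or_nonempty with rfl | hne
  · have hempty : ∀ D ∈ P, D = ∅ := fun D hD => by
      obtain ⟨f, rfl⟩ := hP.1 D hD
      exact Set.image_empty f
    exact ⟨{∅}, ⟨by simpa using ⟨IsometryEquiv.refl _, by simp⟩, Set.pairwise_singleton _ _⟩,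
      completelySaturated_singleton_empty,
      isLimitOf_of_forall_eq_empty (by simp) hempty, isLimitOf_of_forall_eq_empty hempty (by simp)⟩
  obtain ⟨Q, hQ, hQsat, hQP⟩ := exists_completelySaturated_isLimitOf hK hne hP
    fun v r ε m k hε => by
      obtain ⟨R, hR⟩ := hur.exists_dist_le_packingNear hK hne hP v r hε
      obtain ⟨c, hc⟩ := hd.exists_forall_not_hasImprovement hK hne hP R k m
      obtain ⟨w, hw, hnear⟩ := hR (-c)
      refine ⟨w, hnear, fun himp => hc (0 - w) ?_ himp.of_translatePacking⟩
      rwa [zero_sub, ← dist_neg_neg, neg_neg]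
  exact ⟨Q, hQ, hQsat, hQP, hur Q hQ hQP⟩
end
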